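/- arXiv:2506.07846 — 2 statements merged into one kernel-verified Lean document; each statement's English description precedes it below -/
import Mathlib

section
/- Let C be a Griesmer [g_q(k,d),k,d] code over F_q with q = p^f, p prime. If q^e divides d, then p^e divides the weight of every codeword of C. -/
/-- Hamming weight of a vector. -/
noncomputable def wt {ι F : Type*} [Zero F] (c : ι → F) : ℕ :=
  Nat.card {i // c i ≠ 0}

/-- Griesmer sum `g_q(k,d) = ∑_{i<k} ⌈d / q^i⌉` (using `(d + q^i - 1)/q^i`). -/
def gbound (q k d : ℕ) : ℕ :=
  ∑ i ∈ Finset.range k, (d + q ^ i - 1) / q ^ i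

namespace Grie
open Finset
set_option linter.unusedSectionVars false

lemma ceil_le {q d w : ℕ} (hq : 0 < q) : (d + q - 1) / q ≤ w ↔ d ≤ q * w := by
  rw [← Nat.lt_succ_iff, Nat.div_lt_iff_lt_mul hq]
  rw [Nat.succ_mul, mul_comm w q]
  omega

lemma ceil_ceil {q d i : ℕ} (hq : 0 < q) :
    (d + q ^ (i+1) - 1) / q ^ (i+1) = ((d + q - 1) / q + q ^ i - 1) / q ^ i := by
  apply eq_of_forall_ge_iff
  intro c
  rw [ceil_le (pow_pos hq _), ceil_le (pow_pos hq _), ceil_le hq]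
  rw [pow_succ', mul_assoc]

lemma gbound_succ {q k d : ℕ} (hq : 0 < q) :
    gbound q (k+1) d = d + gbound q k ((d + q - 1) / q) := by
  unfold gbound
  rw [Finset.sum_range_succ', add_comm]
  congr 1
  · simp
  · apply Finset.sum_congr rfl
    intro i _
    exact ceil_ceil hq

lemma gbound_mono {q k d d' : ℕ} (h : d ≤ d') : gbound q k d ≤ gbound q k d' := by
  unfold gbound
  apply Finset.sum_le_sum
  intro i _
  apply Nat.div_le_div_right
  omega

lemma gbound_lt {q k d : ℕ} (hq : 0 < q) : gbound q (k+1) d < gbound q (k+1) (d+1) := by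
  rw [gbound_succ hq, gbound_succ hq]
  have : gbound q k ((d + q - 1) / q) ≤ gbound q k ((d + 1 + q - 1) / q) := by
    apply gbound_mono
    apply Nat.div_le_div_right
    omega
  omega

lemma gbound_last {q k d : ℕ} : gbound q (k+1) d = gbound q k d + (d + q ^ k - 1) / q ^ k := by
  unfold gbound
  rw [Finset.sum_range_succ]

section
variable {F : Type*} [Field F] [Fintype F] {n : ℕ}

open Classical in
noncomputable def wS (S : Finset (Fin n)) (x : Fin n → F) : ℕ := (S.filter (fun j => x j ≠ 0)).card

open Classical in
noncomputable def zS (S : Finset (Fin n)) (x : Fin n → F) : Finset (Fin n) := S.filter (fun j => x j = 0)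

lemma card_zS (S : Finset (Fin n)) (x : Fin n → F) : (zS S x).card + wS S x = S.card := by
  classical
  unfold zS wS
  exact Finset.card_filter_add_card_filter_not _

lemma wS_univ (x : Fin n → F) : wS Finset.univ x = wt x := by
  classical
  unfold wS wt
  rw [Nat.card_eq_fintype_card, Fintype.card_subtype]

open Classical in
lemma wS_eq_sum (S : Finset (Fin n)) (x : Fin n → F) :
    wS S x = ∑ j ∈ S, if x j ≠ 0 then 1 else 0 := by
  unfold wS
  rw [Finset.card_filter]

lemma wS_smul (S : Finset (Fin n)) (x : Fin n → F) {c : F} (hc : c ≠ 0) :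
    wS S (c • x) = wS S x := by
  classical
  simp_rw [wS_eq_sum]
  apply Finset.sum_congr rfl
  intro j _
  simp [hc]

/-- the fundamental residual identity -/
lemma sum_line (S : Finset (Fin n)) (x y : Fin n → F) :
    ∑ c : F, wS S (y + c • x) = Fintype.card F * wS (zS S x) y + (Fintype.card F - 1) * wS S x := by
  classical
  simp_rw [wS_eq_sum]
  rw [Finset.sum_comm]
  unfold zS
  rw [Finset.sum_filter, Finset.mul_sum, Finset.mul_sum, ← Finset.sum_add_distrib]
  apply Finset.sum_congr rfl
  intro j _
  by_cases hx : x j = 0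
  · simp [hx]
  · simp only [hx, if_false, mul_zero, zero_add, ne_eq, not_false_eq_true, if_true, mul_one]
    have : (∑ c : F, if ¬ (y + c • x) j = 0 then 1 else 0)
        = ∑ c : F, if c = - y j / x j then 0 else 1 := by
      apply Finset.sum_congr rfl
      intro c _
      have : (y + c • x) j = 0 ↔ c = - y j / x j := by
        simp only [Pi.add_apply, Pi.smul_apply, smul_eq_mul]
        rw [eq_div_iff hx]
        constructor
        · intro h; linear_combination h
        · intro h; linear_combination h
      by_cases h : c = - y j / x j
      · rw [if_neg (by simpa using this.2 h), if_pos h]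
      · rw [if_pos (by rw [this]; exact h), if_neg h]
    rw [this]
    have h2 := Finset.card_filter (fun c : F => ¬ c = - y j / x j) Finset.univ
    simp only [ite_not] at h2
    rw [← h2, Finset.filter_ne', Finset.card_erase_of_mem (Finset.mem_univ _), Finset.card_univ]

lemma res_bound (S : Finset (Fin n)) (x y : Fin n → F) (w : ℕ) (hx : wS S x = w)
    (h : ∀ c : F, w ≤ wS S (y + c • x)) :
    w ≤ Fintype.card F * wS (zS S x) y := by
  have h1 := sum_line S x y
  have h2 : Fintype.card F * w ≤ ∑ c : F, wS S (y + c • x) := by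
    calc Fintype.card F * w = ∑ c : F, w := by simp
      _ ≤ _ := Finset.sum_le_sum (fun c _ => h c)
  rw [h1, hx] at h2
  have hq : 1 ≤ Fintype.card F := Fintype.card_pos
  obtain ⟨q', hq'⟩ := Nat.exists_eq_add_of_le hq
  rw [hq'] at h2 ⊢
  simp only [Nat.add_sub_cancel_left] at h2
  nlinarith

lemma exists_compl (C : Submodule F (Fin n → F)) (D : Submodule F (Fin n → F)) (h : D ≤ C) :
    ∃ C' : Submodule F (Fin n → F), C' ≤ C ∧ Disjoint D C' ∧ D ⊔ C' = C ∧
      Module.finrank F D + Module.finrank F C' = Module.finrank F C := by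
  obtain ⟨E, hE⟩ := Submodule.exists_isCompl D
  refine ⟨E ⊓ C, inf_le_right, hE.disjoint.mono_right inf_le_left, ?_, ?_⟩
  · rw [← sup_inf_assoc_of_le E h, hE.sup_eq_top, top_inf_eq]
  · have := Submodule.finrank_sup_add_finrank_inf_eq D (E ⊓ C)
    rw [← sup_inf_assoc_of_le E h, hE.sup_eq_top, top_inf_eq, ← inf_assoc, hE.inf_eq_bot] at this
    rw [bot_inf_eq, finrank_bot] at this
    omega

lemma griesmer (k : ℕ) : ∀ (C : Submodule F (Fin n → F)) (S : Finset (Fin n)) (d : ℕ),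
    Module.finrank F C = k → (∀ x ∈ C, x ≠ 0 → d ≤ wS S x) →
    gbound (Fintype.card F) k d ≤ S.card := by
  induction k with
  | zero => intro C S d _ _; simp [gbound]
  | succ k ih =>
    intro C S d hk hd
    have hq : 0 < Fintype.card F := Fintype.card_pos
    have hne : ∃ w, ∃ x ∈ C, x ≠ 0 ∧ wS S x = w := by
      have : C ≠ ⊥ := by rintro rfl; simp at hk
      obtain ⟨x, hx, hx0⟩ := Submodule.exists_mem_ne_zero_of_ne_bot this
      exact ⟨_, x, hx, hx0, rfl⟩
    classical
    obtain ⟨x, hx, hx0, hw⟩ := Nat.find_spec hne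
    set w := Nat.find hne with hwdef
    have hmin : ∀ y ∈ C, y ≠ 0 → w ≤ wS S y := fun y hy hy0 => Nat.find_min' hne ⟨y, hy, hy0, rfl⟩
    obtain ⟨C', hC', hdis, hsup, hfr⟩ := exists_compl C (Submodule.span F {x}) (by simpa using hx)
    rw [finrank_span_singleton hx0] at hfr
    have key := ih C' (zS S x) ((w + Fintype.card F - 1) / Fintype.card F) (by omega) (by
      intro y hy hy0
      rw [ceil_le hq]
      apply res_bound S x y w hw
      intro c
      apply hmin _ (C.add_mem (hC' hy) (C.smul_mem c hx))
      intro h0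
      apply hy0
      have hy2 : y ∈ Submodule.span F {x} := by
        rw [Submodule.mem_span_singleton]
        exact ⟨-c, by rw [neg_smul]; exact (eq_neg_of_add_eq_zero_left h0).symm⟩
      exact Submodule.disjoint_def.1 hdis y hy2 hy)
    have h3 := card_zS S x
    calc gbound _ (k+1) d ≤ gbound _ (k+1) w := gbound_mono (by rw [← hw]; exact hd x hx hx0)
      _ = w + gbound _ k _ := gbound_succ hq
      _ ≤ S.card := by omega

structure Gr (C : Submodule F (Fin n → F)) (S : Finset (Fin n)) (d : ℕ) : Prop where
  pos : 1 ≤ d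
  low : ∀ x ∈ C, x ≠ 0 → d ≤ wS S x
  len : S.card ≤ gbound (Fintype.card F) (Module.finrank F C) d

lemma Gr.exists_min {C : Submodule F (Fin n → F)} {S : Finset (Fin n)} {d : ℕ} (h : Gr C S d)
    (hk : 1 ≤ Module.finrank F C) : ∃ x ∈ C, x ≠ 0 ∧ wS S x = d := by
  by_contra! hcon
  have := griesmer _ C S (d+1) rfl (fun x hx hx0 =>
    Nat.succ_le_of_lt (lt_of_le_of_ne (h.low x hx hx0) (Ne.symm (hcon x hx hx0))))
  have h2 := h.len
  obtain ⟨k, hk'⟩ := Nat.exists_eq_add_of_le' hk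
  rw [hk'] at this h2
  have := gbound_lt (k := k) (d := d) (Fintype.card_pos (α := F))
  omega

lemma Gr.exists_T (e : ℕ) : ∀ {C : Submodule F (Fin n → F)} {S : Finset (Fin n)} {d : ℕ},
    Gr C S d → Fintype.card F ^ e ∣ d → e + 1 ≤ Module.finrank F C →
    ∃ T : Submodule F (Fin n → F), T ≤ C ∧ Module.finrank F T = e + 1 ∧
      ∀ t ∈ T, t ≠ 0 → wS S t = d := by
  have hq : 0 < Fintype.card F := Fintype.card_pos
  induction e with
  | zero =>
    intro C S d h _ hk
    obtain ⟨x, hx, hx0, hw⟩ := h.exists_min hk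
    refine ⟨Submodule.span F {x}, by simpa using hx, finrank_span_singleton hx0, ?_⟩
    intro t ht ht0
    obtain ⟨c, rfl⟩ := Submodule.mem_span_singleton.1 ht
    have hc : c ≠ 0 := by rintro rfl; simp at ht0
    rw [← hw, wS_smul S x hc]
  | succ e ih =>
    intro C S d h hd hk
    obtain ⟨x, hx, hx0, hw⟩ := h.exists_min (by omega)
    obtain ⟨C', hC', hdis, hsup, hfr⟩ := exists_compl C (Submodule.span F {x}) (by simpa using hx)
    rw [finrank_span_singleton hx0] at hfr
    obtain ⟨d', hd'⟩ := hd
    have hd1 : d = Fintype.card F * (Fintype.card F ^ e * d') := by rw [hd']; ring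
    set d1 := Fintype.card F ^ e * d' with hd1def
    have hne : ∀ y ∈ C', y ≠ 0 → ∀ c : F, y + c • x ≠ 0 := by
      intro y hy hy0 c h0
      apply hy0
      have hy2 : y ∈ Submodule.span F {x} := by
        rw [Submodule.mem_span_singleton]
        exact ⟨-c, by rw [neg_smul]; exact (eq_neg_of_add_eq_zero_left h0).symm⟩
      exact Submodule.disjoint_def.1 hdis y hy2 hy
    have hceil : (d + Fintype.card F - 1) / Fintype.card F = d1 := by
      apply eq_of_forall_ge_iff
      intro c
      rw [ceil_le hq, hd1]
      exact Nat.mul_le_mul_left_iff hq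
    have hG : Gr C' (zS S x) d1 := by
      constructor
      · have := h.pos
        rcases Nat.eq_zero_or_pos d1 with h0 | h0
        · rw [h0] at hd1; omega
        · exact h0
      · intro y hy hy0
        rw [← hceil, ceil_le hq]
        apply res_bound S x y d hw
        intro c
        exact h.low _ (C.add_mem (hC' hy) (C.smul_mem c hx)) (hne y hy hy0 c)
      · have h3 := card_zS S x
        have h4 := h.len
        rw [show Module.finrank F C = Module.finrank F C' + 1 by omega, gbound_succ hq, hceil] at h4
        omega
    obtain ⟨T', hT', hfT, hwT⟩ := ih hG ⟨d', rfl⟩ (by omega)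
    refine ⟨Submodule.span F {x} ⊔ T', ?_, ?_, ?_⟩
    · exact sup_le (by simpa using hx) (hT'.trans hC')
    · have := Submodule.finrank_sup_add_finrank_inf_eq (Submodule.span F {x}) T'
      rw [(hdis.mono_right hT').eq_bot, finrank_span_singleton hx0] at this
      simp at this
      omega
    · intro t ht ht0
      obtain ⟨a, ha, y, hy, rfl⟩ := Submodule.mem_sup.1 ht
      obtain ⟨c, rfl⟩ := Submodule.mem_span_singleton.1 ha
      by_cases hy0 : y = 0
      · subst hy0
        have hc : c ≠ 0 := by rintro rfl; simp at ht0
        rw [← hw, add_zero, wS_smul S x hc]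
      · have h1 := sum_line S x y
        rw [hwT y hy hy0, hw] at h1
        have h2 : ∑ c : F, wS S (y + c • x) = ∑ c : F, d := by
          rw [h1, ← hd1]
          simp only [Finset.sum_const, Finset.card_univ, smul_eq_mul]
          obtain ⟨q', hq'⟩ := Nat.exists_eq_add_of_le hq
          rw [hq']
          simp only [Nat.succ_eq_add_one, Nat.add_sub_cancel_left]
          ring_nf
        have h3 := (Finset.sum_eq_sum_iff_of_le (fun c _ =>
          h.low _ (C.add_mem (hC' (hT' hy)) (C.smul_mem c hx)) (hne y (hT' hy) hy0 c))).1 h2.symm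
        rw [add_comm]
        exact (h3 c (Finset.mem_univ _)).symm

open Classical in
noncomputable def NS (S : Finset (Fin n)) (T : Submodule F (Fin n → F)) : Finset (Fin n) :=
  S.filter (fun j => ∃ t ∈ T, t j ≠ 0)

open Classical in
lemma card_nonzero {V : Type*} [AddCommGroup V] [Module F V] [Fintype V] [FiniteDimensional F V]
    (φ : V →ₗ[F] F) (h : φ ≠ 0) :
    Fintype.card F * (Finset.univ.filter (fun t => φ t ≠ 0)).card
      + Fintype.card F ^ Module.finrank F V = Fintype.card F * Fintype.card F ^ Module.finrank F V := by
  have h1 := Module.Dual.finrank_ker_add_one_of_ne_zero (f := φ) h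
  have h2 : (Finset.univ.filter (fun t => φ t = 0)).card = Fintype.card F ^ Module.finrank F (LinearMap.ker φ) := by
    have := Module.card_eq_pow_finrank (K := F) (V := LinearMap.ker φ)
    rw [← this, ← Fintype.card_subtype]
    rfl
  have h3 := Finset.card_filter_add_card_filter_not (s := (Finset.univ : Finset V)) (fun t => φ t = 0)
  rw [Finset.card_univ, Module.card_eq_pow_finrank (K := F) (V := V), h2] at h3
  rw [← h1] at h3 ⊢
  have h4 : (Finset.univ.filter (fun t => φ t ≠ 0)).card
      = (Finset.univ.filter (fun t => ¬ φ t = 0)).card := rfl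
  rw [h4]
  have h5 := congrArg (fun z => Fintype.card F * z) h3
  rw [← h5]
  ring

lemma card_NS (S : Finset (Fin n)) (T : Submodule F (Fin n → F)) (d : ℕ)
    (h : ∀ t ∈ T, t ≠ 0 → wS S t = d) :
    (Fintype.card F : ℤ) * d * ((Fintype.card F : ℤ) ^ Module.finrank F T - 1)
      = (NS S T).card * (Fintype.card F - 1) * (Fintype.card F : ℤ) ^ Module.finrank F T := by
  classical
  have h1 : ∑ t : T, wS S (t : Fin n → F) + d = d * Fintype.card F ^ Module.finrank F T := by
    rw [← Module.card_eq_pow_finrank (K := F) (V := T)]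
    rw [← Finset.add_sum_erase _ _ (Finset.mem_univ (0 : T))]
    have h0 : wS S ((0 : T) : Fin n → F) = 0 := by
      rw [wS_eq_sum]; simp
    have h2 : ∑ t ∈ Finset.univ.erase (0 : T), wS S (t : Fin n → F)
        = ∑ t ∈ Finset.univ.erase (0 : T), d := by
      apply Finset.sum_congr rfl
      intro t ht
      apply h t t.2
      simpa using Finset.ne_of_mem_erase ht
    rw [h0, h2, Finset.sum_const, Finset.card_erase_of_mem (Finset.mem_univ _), Finset.card_univ]
    have : 1 ≤ Fintype.card T := Fintype.card_pos
    obtain ⟨q', hq'⟩ := Nat.exists_eq_add_of_le this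
    rw [hq', smul_eq_mul, Nat.add_sub_cancel_left]
    ring
  have h2 : Fintype.card F * ∑ t : T, wS S (t : Fin n → F)
      + (NS S T).card * Fintype.card F ^ Module.finrank F T
      = (NS S T).card * (Fintype.card F * Fintype.card F ^ Module.finrank F T) := by
    simp_rw [wS_eq_sum]
    rw [Finset.sum_comm, NS, Finset.card_filter, Finset.sum_mul, Finset.sum_mul, Finset.mul_sum,
      ← Finset.sum_add_distrib]
    apply Finset.sum_congr rfl
    intro j _
    rw [← Finset.card_filter]
    by_cases hj : ∃ t ∈ T, t j ≠ 0
    · rw [if_pos hj]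
      have := card_nonzero ((LinearMap.proj j : (Fin n → F) →ₗ[F] F).comp T.subtype) (by
        obtain ⟨t, ht, htj⟩ := hj
        intro h0
        apply htj
        exact LinearMap.congr_fun h0 ⟨t, ht⟩)
      simp only [LinearMap.comp_apply, Submodule.subtype_apply, LinearMap.proj_apply] at this
      rw [one_mul, one_mul]
      exact this
    · rw [if_neg hj]
      push Not at hj
      simp [hj]
  zify at h1 h2
  linear_combination h2 - (Fintype.card F : ℤ) * h1

lemma card_beta (S : Finset (Fin n)) (T : Submodule F (Fin n → F)) (d m : ℕ)
    (hm : Module.finrank F T = m + 1)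
    (h : ∀ t ∈ T, t ≠ 0 → wS S t = d) (β : T →ₗ[F] F) (hβ : β ≠ 0) :
    ∃ A ⊆ S, A.card * Fintype.card F ^ m = d ∧
      ∀ j ∈ A, ∃ c : F, c ≠ 0 ∧ ∀ t : T, (t : Fin n → F) j = c * β t := by
  classical
  set K := (LinearMap.ker β).map T.subtype with hK
  have hKT : K ≤ T := by rw [hK]; exact Submodule.map_subtype_le _ _
  have hfK : Module.finrank F K = m := by
    have h1 := Module.Dual.finrank_ker_add_one_of_ne_zero (f := β) hβ
    rw [hK, Submodule.finrank_map_subtype_eq]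
    omega
  have hsub : NS S K ⊆ NS S T := by
    intro j hj
    simp only [NS, Finset.mem_filter] at hj ⊢
    obtain ⟨hjS, t, ht, htj⟩ := hj
    exact ⟨hjS, t, hKT ht, htj⟩
  have e1 := card_NS S T d h
  have e2 := card_NS S K d (fun t ht => h t (hKT ht))
  refine ⟨NS S T \ NS S K, Finset.sdiff_subset.trans (Finset.filter_subset _ _), ?_, ?_⟩
  · rw [hm] at e1
    rw [hfK] at e2
    have hc := Finset.card_sdiff_add_card_eq_card hsub
    have hq1 : 1 < Fintype.card F := Fintype.one_lt_card
    zify at hc hq1 ⊢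
    have h3 : ((Fintype.card F : ℤ) - 1) * Fintype.card F *
      (((NS S T \ NS S K).card : ℤ) * (Fintype.card F : ℤ) ^ m - d) = 0 := by
      rw [← hc] at e1
      linear_combination -e1 + (Fintype.card F : ℤ) * e2
    rcases mul_eq_zero.1 h3 with h4 | h4
    · exfalso
      have : 0 < ((Fintype.card F : ℤ) - 1) * Fintype.card F := by
        apply mul_pos <;> linarith
      omega
    · linarith
  · intro j hj
    rw [Finset.mem_sdiff] at hj
    obtain ⟨hj1, hj2⟩ := hj
    simp only [NS, Finset.mem_filter, not_and, not_exists] at hj1 hj2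
    have hj3 := hj2 hj1.1
    have hz : ∀ t : T, β t = 0 → (t : Fin n → F) j = 0 := by
      intro t ht
      by_contra hne
      exact hj3 t ⟨t, ht, rfl⟩ hne
    obtain ⟨t0, ht0⟩ : ∃ t0, β t0 ≠ 0 := by
      by_contra! hcon
      exact hβ (LinearMap.ext hcon)
    have hfor : ∀ t : T, (t : Fin n → F) j = (t0 : Fin n → F) j / β t0 * β t := by
      intro t
      have := hz (t - (β t / β t0) • t0) (by simp [ht0])
      simp only [Submodule.coe_sub, Submodule.coe_smul, Pi.sub_apply, Pi.smul_apply, smul_eq_mul] at this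
      field_simp
      field_simp at this
      linear_combination this
    refine ⟨(t0 : Fin n → F) j / β t0, ?_, hfor⟩
    intro h0
    obtain ⟨_, t, ht, htj⟩ := hj1
    apply htj
    have := hfor ⟨t, ht⟩
    rw [h0, zero_mul] at this
    exact this

lemma Gr.exists_hyper {C : Submodule F (Fin n → F)} {S : Finset (Fin n)} {d m : ℕ} (h : Gr C S d)
    {T : Submodule F (Fin n → F)} (hTC : T ≤ C) (hm : Module.finrank F T = m + 1)
    (hT : ∀ t ∈ T, t ≠ 0 → wS S t = d) (β : T →ₗ[F] F) (hβ : β ≠ 0) :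
    ∃ (l : C →ₗ[F] F) (H : Submodule F (Fin n → F)) (S' : Finset (Fin n)),
      (∀ t : T, l ⟨t, hTC t.2⟩ = β t) ∧ (∀ z : C, l z = 0 → (z : Fin n → F) ∈ H) ∧
      Module.finrank F H + 1 = Module.finrank F C ∧ Gr H S' d ∧
      ∀ z ∈ H, wS S' z = wS S z := by
  classical
  have hq : 0 < Fintype.card F := Fintype.card_pos
  obtain ⟨A, hAS, hA, hAc⟩ := card_beta S T d m hm hT β hβ
  choose! c hc0 hc using hAc
  obtain ⟨T', hT'C, hdis, hsup, hfr⟩ := exists_compl C T hTC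
  set k' := Module.finrank F T' with hk'
  let g : Fin n → (T' →ₗ[F] F) := fun j =>
    (c j)⁻¹ • ((LinearMap.proj j : (Fin n → F) →ₗ[F] F).comp T'.subtype)
  have : Finite (T' →ₗ[F] F) := Module.finite_of_finite F
  have : Fintype (T' →ₗ[F] F) := Fintype.ofFinite _
  have hcard : Fintype.card (T' →ₗ[F] F) = Fintype.card F ^ k' := by
    rw [Module.card_eq_pow_finrank (K := F) (V := (T' →ₗ[F] F))]
    congr 1
    exact Subspace.dual_finrank_eq
  set N := (d + Fintype.card F ^ (m + k') - 1) / Fintype.card F ^ (m + k') with hN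
  have hNpos : 1 ≤ N := by
    by_contra hcon
    have : N ≤ 0 := by omega
    rw [hN, ceil_le (pow_pos hq _)] at this
    have := h.pos
    omega
  obtain ⟨N', hN'⟩ := Nat.exists_eq_add_of_le' hNpos
  have hlt : Fintype.card F ^ k' * N' < A.card := by
    have : ¬ N ≤ N' := by omega
    rw [hN, ceil_le (pow_pos hq _), not_le, ← hA, pow_add] at this
    have hp : 0 < Fintype.card F ^ m := pow_pos hq _
    by_contra hcon
    push Not at hcon
    have := Nat.mul_le_mul_right (Fintype.card F ^ m) hcon
    nlinarith
  obtain ⟨y, _, hy⟩ := Finset.exists_lt_card_fiber_of_mul_lt_card_of_maps_to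
    (s := A) (t := Finset.univ) (f := g) (n := N') (fun _ _ => Finset.mem_univ _)
    (by rw [Finset.card_univ, hcard]; exact hlt)
  set B := A.filter (fun j => g j = y) with hB
  have hBne : B.Nonempty := Finset.card_pos.1 (by omega)
  obtain ⟨j0, hj0⟩ := hBne
  have hBA : ∀ j ∈ B, j ∈ A := fun j hj => (Finset.mem_filter.1 hj).1
  have hBg : ∀ j ∈ B, g j = y := fun j hj => (Finset.mem_filter.1 hj).2
  let l : C →ₗ[F] F := (c j0)⁻¹ • ((LinearMap.proj j0 : (Fin n → F) →ₗ[F] F).comp C.subtype)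
  have hlT : ∀ t : T, l ⟨t, hTC t.2⟩ = β t := by
    intro t
    simp only [l, LinearMap.smul_apply, LinearMap.comp_apply, Submodule.subtype_apply,
      LinearMap.proj_apply, smul_eq_mul]
    rw [hc j0 (hBA _ hj0) t, inv_mul_cancel_left₀ (hc0 j0 (hBA _ hj0))]
  have hlB : ∀ j ∈ B, ∀ z : C, (z : Fin n → F) j = c j * l z := by
    intro j hj z
    have hcj := hc0 j (hBA _ hj)
    have hcj0 := hc0 j0 (hBA _ hj0)
    obtain ⟨z, hz⟩ := z
    have hz' := hz
    rw [← hsup] at hz'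
    obtain ⟨t, ht, s, hs, rfl⟩ := Submodule.mem_sup.1 hz'
    have e1 : (c j)⁻¹ * s j = (c j0)⁻¹ * s j0 :=
      LinearMap.congr_fun ((hBg j hj).trans (hBg j0 hj0).symm) ⟨s, hs⟩
    have e2 := hc j (hBA _ hj) ⟨t, ht⟩
    have e3 := hc j0 (hBA _ hj0) ⟨t, ht⟩
    simp only [l, LinearMap.smul_apply, LinearMap.comp_apply, Submodule.subtype_apply,
      LinearMap.proj_apply, smul_eq_mul, Pi.add_apply] at e2 e3 ⊢
    rw [e2, e3]
    field_simp at e1 ⊢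
    linear_combination e1
  have hl0 : l ≠ 0 := by
    rintro h0
    apply hβ
    ext t
    rw [← hlT t, h0]; rfl
  have hHS : ∀ z ∈ (LinearMap.ker l).map C.subtype, wS (S \ B) z = wS S z := by
    rintro _ ⟨z, hz, rfl⟩
    unfold wS
    congr 1
    ext j
    simp only [Finset.mem_filter, Finset.mem_sdiff]
    constructor
    · rintro ⟨⟨a, _⟩, b⟩; exact ⟨a, b⟩
    · rintro ⟨a, b⟩
      refine ⟨⟨a, fun hjB => b ?_⟩, b⟩
      have hz0 : l z = 0 := hz
      have := hlB j hjB z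
      rw [hz0, mul_zero] at this
      exact this
  have hfin : Module.finrank F ((LinearMap.ker l).map C.subtype) + 1 = Module.finrank F C := by
    rw [Submodule.finrank_map_subtype_eq]
    exact Module.Dual.finrank_ker_add_one_of_ne_zero hl0
  refine ⟨l, (LinearMap.ker l).map C.subtype, S \ B, hlT, ?_, hfin, ?_, hHS⟩
  · intro z hz
    exact ⟨z, hz, rfl⟩
  · refine ⟨h.pos, ?_, ?_⟩
    · intro x hx hx0
      rw [hHS x hx]
      exact h.low x (Submodule.map_subtype_le _ _ hx) hx0
    · have h4 := h.len
      rw [← hfin, gbound_last] at h4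
      have h5 : Module.finrank F ((LinearMap.ker l).map C.subtype) = m + k' := by omega
      have hBS : B ⊆ S := fun j hj => hAS (hBA j hj)
      have := Finset.card_sdiff_add_card_eq_card hBS
      rw [h5] at h4 ⊢
      omega
end
end Grie

namespace Grie
section Moment
open Finset
set_option linter.unusedSectionVars false
variable {p : ℕ} [hp : Fact p.Prime] {F : Type*} [Field F] [Fintype F] [CharP F p]

local notation "tm" => WittVector.teichmuller p (R := F)

lemma tm_pow_card (x : F) : tm x ^ Fintype.card F = tm x := by
  rw [← map_pow, FiniteField.pow_card]

lemma tm_inj {x y : F} (h : tm x = tm y) : x = y := by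
  have := congrArg (fun w => WittVector.coeff w 0) h
  simpa [WittVector.teichmuller_coeff_zero] using this

lemma tm_cc (x : F) : WittVector.constantCoeff (tm x) = x := by
  simp [WittVector.constantCoeff, WittVector.teichmuller_coeff_zero]

lemma p_dvd_iff (a : WittVector p F) : (p : WittVector p F) ∣ a ↔ WittVector.constantCoeff a = 0 := by
  rw [← Ideal.mem_span_singleton, ← WittVector.ker_constantCoeff]
  rfl

lemma tm_sub_one [DecidableEq F] (x : F) : tm x ^ (Fintype.card F - 1) = if x ≠ 0 then 1 else 0 := by
  have : Fintype.card F - 1 ≠ 0 := by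
    have := Fintype.one_lt_card (α := F); omega
  split_ifs with h
  · rw [← map_pow, FiniteField.pow_card_sub_one_eq_one x h, map_one]
  · push Not at h
    rw [h, WittVector.teichmuller_zero, zero_pow this]

lemma sum_tm_dvd (h : ℕ) (hh : h < Fintype.card F - 1) :
    (p : WittVector p F) ∣ ∑ x : F, tm x ^ h := by
  rcases Nat.eq_zero_or_pos h with rfl | hpos
  · simp only [pow_zero, sum_const, card_univ, nsmul_eq_mul, mul_one]
    rw [p_dvd_iff]
    simp
  · classical
    have h1 : ∑ x : F, tm x ^ h = ∑ u : Fˣ, tm (u : F) ^ h := by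
      rw [← Fintype.sum_subtype_add_sum_subtype (fun x : F => x ≠ 0) (fun x : F => tm x ^ h)]
      have e0 : ∑ x : {x : F // ¬ x ≠ 0}, tm (x : F) ^ h = 0 := by
        apply Finset.sum_eq_zero
        rintro ⟨x, hx⟩ _
        push Not at hx
        simp [hx, WittVector.teichmuller_zero, hpos.ne']
      rw [e0, add_zero]
      symm
      exact Fintype.sum_equiv unitsEquivNeZero _ _ (fun u => rfl)
    let φ : Fˣ →* WittVector p F := (powMonoidHom h).comp ((WittVector.teichmuller p).comp (Units.coeHom F))
    have h2 := sum_hom_units φ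
    have h3 : φ ≠ 1 := by
      intro h4
      have : ∀ u : Fˣ, u ^ h = 1 := by
        intro u
        have h5 := DFunLike.congr_fun h4 u
        simp only [φ, MonoidHom.comp_apply, powMonoidHom_apply, Units.coeHom_apply, MonoidHom.one_apply] at h5
        rw [← map_pow, ← map_one (WittVector.teichmuller p)] at h5
        ext
        simpa using tm_inj h5
      have := (FiniteField.forall_pow_eq_one_iff F h).1 this
      exact absurd (Nat.le_of_dvd hpos this) (by omega)
    rw [if_neg h3] at h2
    rw [h1]
    have : ∑ u : Fˣ, tm (u : F) ^ h = 0 := by exact_mod_cast h2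
    rw [this]
    exact dvd_zero _

variable {m : ℕ}

noncomputable def mon (p : ℕ) [Fact p.Prime] {F : Type*} [Field F] {m : ℕ} (a : Fin m → ℕ) :
    (Fin m → F) → WittVector p F :=
  fun y => ∏ i, (WittVector.teichmuller p (y i)) ^ a i

lemma mon_mul (a b : Fin m → ℕ) : mon p (F := F) a * mon p b = mon p (a + b) := by
  ext1 y
  simp [mon, pow_add, Finset.prod_mul_distrib]

lemma mon_zero : mon p (F := F) (0 : Fin m → ℕ) = 1 := by
  ext1 y
  simp [mon]

lemma mon_pow (a : Fin m → ℕ) : mon p (F := F) a ^ (Fintype.card F) = mon p a := by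
  ext1 y
  simp only [mon, Pi.pow_apply]
  rw [← Finset.prod_pow]
  apply Finset.prod_congr rfl
  intro i _
  rw [pow_right_comm, tm_pow_card]

def gens (p : ℕ) [Fact p.Prime] (F : Type*) [Field F] [Fintype F] (m N : ℕ) :
    Set ((Fin m → F) → WittVector p F) :=
  {g | ∃ (i : ℕ) (a : Fin m → ℕ), ∑ j, a j ≤ N + i * (Fintype.card F - 1) ∧
    g = (p : WittVector p F) ^ i • mon p a}

noncomputable def FN (p : ℕ) [Fact p.Prime] (F : Type*) [Field F] [Fintype F] (m N : ℕ) :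
    Submodule (WittVector p F) ((Fin m → F) → WittVector p F) :=
  Submodule.span _ (gens p F m N)

lemma FN_mono {N N' : ℕ} (h : N ≤ N') : FN p F m N ≤ FN p F m N' := by
  apply Submodule.span_mono
  rintro _ ⟨i, a, ha, rfl⟩
  exact ⟨i, a, by omega, rfl⟩

lemma FN_mul {N N' : ℕ} {f g : (Fin m → F) → WittVector p F} (hf : f ∈ FN p F m N)
    (hg : g ∈ FN p F m N') : f * g ∈ FN p F m (N + N') := by
  have h1 := Submodule.mul_mem_mul hf hg
  unfold FN at h1
  rw [Submodule.span_mul_span] at h1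
  refine Submodule.span_mono ?_ h1
  rintro _ ⟨_, ⟨i, a, ha, rfl⟩, _, ⟨j, b, hb, rfl⟩, rfl⟩
  refine ⟨i + j, a + b, ?_, ?_⟩
  · simp only [Pi.add_apply, Finset.sum_add_distrib]
    rw [add_mul]
    omega
  · simp only
    rw [smul_mul_smul_comm, mon_mul, pow_add]

lemma FN_mon {N : ℕ} (a : Fin m → ℕ) (h : ∑ j, a j ≤ N) : mon p a ∈ FN p F m N :=
  Submodule.subset_span ⟨0, a, by omega, by simp⟩

lemma FN_one {N : ℕ} : 1 ∈ FN p F m N := by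
  rw [← mon_zero]
  exact FN_mon _ (by simp)

lemma FN_pow {N : ℕ} {f : (Fin m → F) → WittVector p F} (hf : f ∈ FN p F m N) (k : ℕ) :
    f ^ k ∈ FN p F m (k * N) := by
  induction k with
  | zero => rw [pow_zero]; exact FN_one
  | succ k ih =>
    rw [pow_succ, add_mul, one_mul]
    exact FN_mul ih hf

lemma FN_p {N : ℕ} {f : (Fin m → F) → WittVector p F}
    (hf : f ∈ FN p F m (N + (Fintype.card F - 1))) : (p : WittVector p F) • f ∈ FN p F m N := by
  unfold FN at hf
  induction hf using Submodule.span_induction with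
  | mem x hx =>
    obtain ⟨i, a, ha, rfl⟩ := hx
    refine Submodule.subset_span ⟨i+1, a, ?_, ?_⟩
    · rw [add_mul, one_mul]; omega
    · rw [smul_smul, pow_succ']
  | zero => simp
  | add x y _ _ hx hy => rw [smul_add]; exact Submodule.add_mem _ hx hy
  | smul c x _ hx => rw [smul_comm]; exact Submodule.smul_mem _ _ hx

lemma FN_nat {N : ℕ} {g : (Fin m → F) → WittVector p F} (hg : g ∈ FN p F m N) (c : ℕ) :
    g * (c : (Fin m → F) → WittVector p F) ∈ FN p F m N := by
  have : g * (c : (Fin m → F) → WittVector p F) = (c : WittVector p F) • g := by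
    ext1 t
    rw [Pi.mul_apply, Pi.natCast_apply, Pi.smul_apply, smul_eq_mul, mul_comm]
  rw [this]
  exact Submodule.smul_mem _ _ hg

lemma FN_frob {f : ℕ} (hq : Fintype.card F = p ^ f) {g : (Fin m → F) → WittVector p F}
    (hg : g ∈ FN p F m 1) : g ^ Fintype.card F ∈ FN p F m 1 := by
  have hq1 : 1 < Fintype.card F := Fintype.one_lt_card
  unfold FN at hg
  induction hg using Submodule.span_induction with
  | mem x hx =>
    obtain ⟨i, a, ha, rfl⟩ := hx
    rw [smul_pow, mon_pow]
    have : ((p : WittVector p F) ^ i) ^ Fintype.card F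
        = (p : WittVector p F) ^ (i * (Fintype.card F - 1)) * (p : WittVector p F) ^ i := by
      rw [← pow_mul, ← pow_add]
      congr 1
      obtain ⟨q', hq'⟩ := Nat.exists_eq_add_of_le hq1.le
      rw [hq', Nat.add_sub_cancel_left]; ring
    rw [this, ← smul_smul]
    exact Submodule.smul_mem _ _ (Submodule.subset_span ⟨i, a, ha, rfl⟩)
  | zero => rw [zero_pow (by omega)]; exact Submodule.zero_mem _
  | add x y hx' hy' hx hy =>
    have hx'' : x ∈ FN p F m 1 := hx'
    have hy'' : y ∈ FN p F m 1 := hy'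
    have h1 := add_pow_prime_pow_eq' hp.out x y f
    rw [← hq] at h1
    rw [h1]
    refine Submodule.add_mem _ (Submodule.add_mem _ hx hy) ?_
    have h2 : ∀ z : (Fin m → F) → WittVector p F, (p : (Fin m → F) → WittVector p F) * z
        = (p : WittVector p F) • z := by
      intro z; ext1 t; simp
    rw [h2]
    apply FN_p
    apply Submodule.sum_mem
    intro k hk
    rw [Finset.mem_Ioo] at hk
    have h3 : x ^ k * y ^ (Fintype.card F - k) ∈ FN p F m (1 + (Fintype.card F - 1)) := by
      have := FN_mul (FN_pow hx'' k) (FN_pow hy'' (Fintype.card F - k))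
      refine FN_mono ?_ this
      omega
    exact FN_nat h3 _
  | smul c x _ hx => rw [smul_pow]; exact Submodule.smul_mem _ _ hx

lemma form_approx {f : ℕ} (hf : 1 ≤ f) (hq : Fintype.card F = p ^ f) (e : ℕ) (γ : F) (B : Fin m → F) :
    ∃ h ∈ FN p F m 1, ∀ y, (p : WittVector p F) ^ e ∣ tm (γ + ∑ i, B i * y i) - h y := by
  set l : (Fin m → F) → WittVector p F := fun y => tm γ + ∑ i, tm (B i) * tm (y i) with hl
  have hl1 : l ∈ FN p F m 1 := by
    have : l = tm γ • (1 : (Fin m → F) → WittVector p F) + ∑ i, tm (B i) • mon p (Pi.single i 1) := by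
      ext1 y
      simp only [hl, Pi.add_apply, Pi.smul_apply, Pi.one_apply, smul_eq_mul, mul_one, Finset.sum_apply]
      congr 1
      apply Finset.sum_congr rfl
      intro i _
      congr 1
      unfold mon
      rw [Finset.prod_eq_single i]
      · simp
      · intro b _ hb; simp [hb]
      · simp
    rw [this]
    apply Submodule.add_mem
    · exact Submodule.smul_mem _ _ FN_one
    · apply Submodule.sum_mem
      intro i _
      apply Submodule.smul_mem
      apply FN_mon
      simp
  have hk : ∀ M : ℕ, l ^ (Fintype.card F ^ M) ∈ FN p F m 1 := by
    intro M
    induction M with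
    | zero => simpa using hl1
    | succ M ih => rw [pow_succ, pow_mul]; exact FN_frob hq ih
  refine ⟨l ^ (Fintype.card F ^ e), hk e, ?_⟩
  intro y
  have h1 : (p : WittVector p F) ∣ tm (γ + ∑ i, B i * y i) - l y := by
    rw [p_dvd_iff]
    simp only [hl, map_sub, map_add, map_sum, map_mul, tm_cc, sub_self]
  have h2 := dvd_sub_pow_of_dvd_sub h1 (f * e)
  rw [pow_mul, ← hq] at h2
  have h3 : tm (γ + ∑ i, B i * y i) ^ Fintype.card F ^ e = tm (γ + ∑ i, B i * y i) := by
    rw [← map_pow, FiniteField.pow_card_pow]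
  rw [h3] at h2
  refine dvd_trans (pow_dvd_pow _ ?_) h2
  nlinarith

lemma sum_FN {e : ℕ} (hm : e + 1 ≤ m) {g : (Fin m → F) → WittVector p F}
    (hg : g ∈ FN p F m (Fintype.card F - 1)) (E : Fin m → ℕ) (hE : ∑ i, E i < Fintype.card F - 1) :
    (p : WittVector p F) ^ e ∣ ∑ y, g y * mon p E y := by
  unfold FN at hg
  induction hg using Submodule.span_induction with
  | mem x hx =>
    obtain ⟨i, a, ha, rfl⟩ := hx
    classical
    have h1 : ∑ y, ((p : WittVector p F) ^ i • mon p a) y * mon p E y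
        = (p : WittVector p F) ^ i * ∏ j, ∑ x : F, tm x ^ (a j + E j) := by
      rw [Finset.prod_univ_sum, Finset.mul_sum, Fintype.piFinset_univ]
      apply Finset.sum_congr rfl
      intro y _
      have := congrFun (mon_mul (p := p) (F := F) a E) y
      rw [Pi.smul_apply, smul_eq_mul, mul_assoc]
      rw [Pi.mul_apply] at this
      rw [this]
      rfl
    rw [h1]
    set c := (Finset.univ.filter (fun j => a j + E j < Fintype.card F - 1)).card with hc
    have h2 : (p : WittVector p F) ^ c ∣ ∏ j, ∑ x : F, tm x ^ (a j + E j) := by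
      rw [← Finset.prod_filter_mul_prod_filter_not Finset.univ (fun j => a j + E j < Fintype.card F - 1)]
      apply Dvd.dvd.mul_right
      rw [hc, ← Finset.prod_const]
      apply Finset.prod_dvd_prod_of_dvd
      intro j hj
      exact sum_tm_dvd _ (Finset.mem_filter.1 hj).2
    have h3 : e ≤ i + c := by
      have h4 : (Finset.univ.filter (fun j => ¬ a j + E j < Fintype.card F - 1)).card * (Fintype.card F - 1)
          ≤ ∑ j, (a j + E j) := by
        calc _ ≤ ∑ j ∈ Finset.univ.filter (fun j => ¬ a j + E j < Fintype.card F - 1), (a j + E j) := by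
              rw [← smul_eq_mul, ← Finset.sum_const]
              apply Finset.sum_le_sum
              intro j hj
              have := (Finset.mem_filter.1 hj).2
              omega
          _ ≤ _ := Finset.sum_le_sum_of_subset (Finset.filter_subset _ _)
      have h5 := Finset.card_filter_add_card_filter_not (s := (Finset.univ : Finset (Fin m)))
        (fun j => a j + E j < Fintype.card F - 1)
      rw [← hc, Finset.card_univ, Fintype.card_fin] at h5
      rw [Finset.sum_add_distrib] at h4
      by_contra hcon
      have h6 : i + 2 ≤ (Finset.univ.filter (fun j => ¬ a j + E j < Fintype.card F - 1)).card := by omega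
      have h7 := Nat.mul_le_mul_right (Fintype.card F - 1) h6
      have h8 : (i + 2) * (Fintype.card F - 1) = i * (Fintype.card F - 1) + (Fintype.card F - 1) + (Fintype.card F - 1) := by ring
      omega
    refine dvd_trans (pow_dvd_pow _ h3) ?_
    rw [pow_add]
    exact mul_dvd_mul_left _ h2
  | zero => simp
  | add x y _ _ hx hy =>
    simp only [Pi.add_apply, add_mul, Finset.sum_add_distrib]
    exact dvd_add hx hy
  | smul c x _ hx =>
    simp only [Pi.smul_apply, smul_eq_mul, mul_assoc]
    rw [← Finset.mul_sum]
    exact Dvd.dvd.mul_left hx c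

theorem moment {f : ℕ} (hf : 1 ≤ f) (hq : Fintype.card F = p ^ f) {e : ℕ} (hm : e + 2 ≤ m)
    {J : Type*} (S : Finset J) (γ : J → F) (B : J → Fin m → F) (V : (Fin m → F) → ℕ)
    [DecidableEq F]
    (hV : ∀ y, p ^ e * V y = (S.filter (fun j => γ j + ∑ i, B j i * y i ≠ 0)).card)
    (E : Fin m → ℕ) (hE : ∑ i, E i < Fintype.card F - 1) :
    ∑ y, (V y : F) * ∏ i, y i ^ E i = 0 := by
  have h1 : ∃ h ∈ FN p F m (Fintype.card F - 1), ∀ y,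
      (p : WittVector p F) ^ (e + 1) ∣ ((p ^ e * V y : ℕ) : WittVector p F) - h y := by
    choose h hF hd using fun j => form_approx (m := m) hf hq (e + 1) (γ j) (B j)
    refine ⟨∑ j ∈ S, h j ^ (Fintype.card F - 1), ?_, ?_⟩
    · apply Submodule.sum_mem
      intro j _
      have := FN_pow (hF j) (Fintype.card F - 1)
      rwa [mul_one] at this
    · intro y
      rw [hV y, Finset.card_filter, Nat.cast_sum, Finset.sum_apply, ← Finset.sum_sub_distrib]
      apply Finset.dvd_sum
      intro j _
      have := tm_sub_one (p := p) (γ j + ∑ i, B j i * y i)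
      push_cast
      rw [← this, Pi.pow_apply]
      exact dvd_trans (hd j y) (sub_dvd_pow_sub_pow _ _ _)
  obtain ⟨h, hh, hd⟩ := h1
  have h2 := sum_FN (e := e + 1) (by omega) hh E hE
  have h3 : (p : WittVector p F) ^ (e + 1) ∣ ∑ y, ((p ^ e * V y : ℕ) : WittVector p F) * mon p E y := by
    have : ∑ y, ((p ^ e * V y : ℕ) : WittVector p F) * mon p E y
        = ∑ y, (((p ^ e * V y : ℕ) : WittVector p F) - h y) * mon p E y + ∑ y, h y * mon p E y := by
      rw [← Finset.sum_add_distrib]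
      apply Finset.sum_congr rfl
      intro y _
      ring
    rw [this]
    apply dvd_add _ h2
    apply Finset.dvd_sum
    intro y _
    exact Dvd.dvd.mul_right (hd y) _
  have h4 : ∑ y, ((p ^ e * V y : ℕ) : WittVector p F) * mon p E y
      = (p : WittVector p F) ^ e * ∑ y, (V y : WittVector p F) * mon p E y := by
    rw [Finset.mul_sum]
    apply Finset.sum_congr rfl
    intro y _
    push_cast; ring
  rw [h4, pow_succ] at h3
  have h5 := (mul_dvd_mul_iff_left (pow_ne_zero e (WittVector.p_nonzero p F))).1 h3
  rw [p_dvd_iff] at h5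
  simpa only [mon, map_sum, map_mul, map_prod, map_pow, map_natCast, tm_cc] using h5

end Moment
end Grie

namespace Grie
section Core
open Finset
set_option linter.unusedSectionVars false

lemma val_pred {f : ℕ} [NeZero f] (a : ZMod f) : (a - 1).val + 1 = if a = 0 then f else a.val := by
  obtain ⟨f, rfl⟩ := Nat.exists_eq_succ_of_ne_zero (NeZero.ne f)
  split_ifs with h
  · subst h
    rw [zero_sub, ZMod.val_neg_one]
  · have h1 : (a - 1) + 1 = a := by ring
    by_cases h2 : (a - 1).val + 1 < f + 1
    · have h5 : (((a - 1).val + 1 : ℕ) : ZMod (f + 1)) = a := by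
        push_cast
        rw [ZMod.natCast_zmod_val]; ring
      have h6 := ZMod.val_natCast (f + 1) ((a - 1).val + 1)
      rw [h5, Nat.mod_eq_of_lt h2] at h6
      exact h6.symm
    · exfalso
      apply h
      have h3 := ZMod.val_lt (a - 1)
      have h4 : (a-1).val = f := by
        simp only [Nat.succ_eq_add_one] at *
        omega
      have h5 := ZMod.natCast_zmod_val (a - 1)
      rw [h4] at h5
      rw [← h1, ← h5]
      have := ZMod.natCast_self (f+1)
      push_cast at this
      exact this

lemma sum_zmod {f : ℕ} [NeZero f] (g : ℕ → ℕ) : ∑ u : ZMod f, g u.val = ∑ i ∈ range f, g i := by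
  obtain ⟨f, rfl⟩ := Nat.exists_eq_succ_of_ne_zero (NeZero.ne f)
  exact Fin.sum_univ_eq_sum_range g (f+1)

lemma sum_pow_val {f p : ℕ} [NeZero f] (hp : 1 ≤ p) :
    ∑ u : ZMod f, (p - 1) * p ^ u.val = p ^ f - 1 := by
  rw [sum_zmod (fun i => (p - 1) * p ^ i), ← Finset.mul_sum, mul_comm]
  exact geom_sum_mul_of_one_le hp f

lemma sum_pow_val' {f p : ℕ} [NeZero f] (hp : 1 ≤ p) (t : ZMod f) :
    ∑ u : ZMod f, (p - 1) * p ^ (u - t).val = p ^ f - 1 := by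
  rw [← sum_pow_val (f := f) hp]
  exact Fintype.sum_equiv (Equiv.subRight t) _ _ (fun u => rfl)

lemma digits_inj {f p : ℕ} [NeZero f] (a b : ZMod f → ℕ) (ha : ∀ u, a u < p) (hb : ∀ u, b u < p)
    (h : ∑ u, a u * p ^ u.val = ∑ u, b u * p ^ u.val) : a = b := by
  obtain ⟨f, rfl⟩ := Nat.exists_eq_succ_of_ne_zero (NeZero.ne f)
  have h1 : finFunctionFinEquiv (fun u : Fin (f+1) => (⟨a u, ha u⟩ : Fin p))
      = finFunctionFinEquiv (fun u : Fin (f+1) => (⟨b u, hb u⟩ : Fin p)) := by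
    apply Fin.ext
    rw [finFunctionFinEquiv_apply, finFunctionFinEquiv_apply]
    exact h
  have h2 := finFunctionFinEquiv.injective h1
  ext u
  have := congrFun h2 u
  simpa using this

lemma exists_sub_sum {ι : Type*} [Fintype ι] (a : ι → ℕ) (n : ℕ) (h : n ≤ ∑ i, a i) :
    ∃ b : ι → ℕ, (∀ i, b i ≤ a i) ∧ ∑ i, b i = n := by
  classical
  induction n with
  | zero => exact ⟨0, by simp, by simp⟩
  | succ n ih =>
    obtain ⟨b, hb, hs⟩ := ih (by omega)
    obtain ⟨i, _, hi⟩ := Finset.exists_lt_of_sum_lt (show ∑ i, b i < ∑ i, a i by omega)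
    refine ⟨b + Pi.single i 1, ?_, ?_⟩
    · intro j
      by_cases hj : j = i
      · subst hj; simp; omega
      · simp [hj, hb j]
    · simp [Finset.sum_add_distrib, hs]

variable {K : Type*} [Field K] [Fintype K] {p f m : ℕ} [NeZero f]

def ev (p : ℕ) {f m : ℕ} [NeZero f] (α : Fin m → ZMod f → ℕ) (x : Fin m → K) : K :=
  ∏ i, ∏ u, (x i ^ p ^ u.val) ^ α i u

def ww (p : ℕ) {f m : ℕ} [NeZero f] (t : ZMod f) (α : Fin m → ZMod f → ℕ) : ℕ :=
  ∑ i, ∑ u, α i u * p ^ (u - t).val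

noncomputable def mu (p : ℕ) {f m : ℕ} [NeZero f] (V : (Fin m → K) → K) (α : Fin m → ZMod f → ℕ) : K :=
  ∑ x, V x * ev p α x

lemma ev_add (α β : Fin m → ZMod f → ℕ) (x : Fin m → K) : ev p (α + β) x = ev p α x * ev p β x := by
  simp [ev, pow_add, Finset.prod_mul_distrib]

lemma ww_add (t : ZMod f) (α β : Fin m → ZMod f → ℕ) : ww p t (α + β) = ww p t α + ww p t β := by
  simp [ww, add_mul, Finset.sum_add_distrib]

lemma ev_single (i : Fin m) (s : ZMod f) (c : ℕ) (x : Fin m → K) :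
    ev p (Pi.single i (Pi.single s c)) x = (x i ^ p ^ s.val) ^ c := by
  unfold ev
  rw [Finset.prod_eq_single i, Finset.prod_eq_single s]
  · simp
  · intro b _ hb; simp [hb]
  · simp
  · intro b _ hb; simp [hb]
  · simp

lemma ww_single (t : ZMod f) (i : Fin m) (s : ZMod f) (c : ℕ) :
    ww p t (Pi.single i (Pi.single s c)) = c * p ^ (s - t).val := by
  unfold ww
  rw [Finset.sum_eq_single i, Finset.sum_eq_single s]
  · simp
  · intro b _ hb; simp [hb]
  · simp
  · intro b _ hb; simp [hb]
  · simp

lemma pow_val (hq : Fintype.card K = p ^ f) (x : K) (n : ℕ) :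
    x ^ p ^ ((n : ZMod f)).val = x ^ p ^ n := by
  rw [ZMod.val_natCast]
  conv_rhs => rw [← Nat.mod_add_div n f, pow_add, pow_mul p f, ← hq, mul_comm, pow_mul,
    FiniteField.pow_card_pow]

/-- shift identity -/
lemma ww_shift (hp : 1 ≤ p) (u : ZMod f) (α : Fin m → ZMod f → ℕ) :
    p * ww p (u + 1) α = ww p u α + (p ^ f - 1) * ∑ i, α i u := by
  unfold ww
  rw [Finset.mul_sum, Finset.mul_sum, ← Finset.sum_add_distrib]
  apply Finset.sum_congr rfl
  intro i _
  have h1 : (p ^ f - 1) * α i u = ∑ v, if v = u then (p ^ f - 1) * α i v else 0 := by simp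
  rw [h1, Finset.mul_sum, ← Finset.sum_add_distrib]
  apply Finset.sum_congr rfl
  intro v _
  have h2 := val_pred (v - u)
  have h3 : v - (u + 1) = v - u - 1 := by ring
  have h4 : p * (α i v * p ^ (v - (u + 1)).val) = α i v * p ^ ((v - u - 1).val + 1) := by
    rw [h3, pow_succ]; ring
  rw [h4, h2]
  by_cases h : v = u
  · subst h
    simp only [sub_self, if_true, ZMod.val_zero, pow_zero, mul_one]
    have : 1 ≤ p ^ f := Nat.one_le_pow _ _ hp
    obtain ⟨c, hc⟩ := Nat.exists_eq_add_of_le this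
    rw [hc, Nat.add_sub_cancel_left]; ring
  · rw [if_neg (sub_ne_zero.2 h), if_neg h, add_zero]

lemma mu_ne_zero (hp : p.Prime) [CharP K p] (hq : Fintype.card K = p ^ f) (V : (Fin m → K) → K)
    (hV : ∀ x, V x ^ p = V x)
    (H1 : ∀ E : Fin m → ℕ, ∑ i, E i < Fintype.card K - 1 → ∑ x, V x * ∏ i, x i ^ E i = 0)
    (α : Fin m → ZMod f → ℕ) (hα : mu p V α ≠ 0) (t : ZMod f) : p ^ f - 1 ≤ ww p t α := by
  by_contra hcon
  push Not at hcon
  apply hα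
  have : Fact p.Prime := ⟨hp⟩
  have h1 := H1 (fun i => ∑ u, α i u * p ^ (u - t).val) (by rw [hq]; exact hcon)
  have hVn : ∀ n x, V x ^ p ^ n = V x := by
    intro n x
    induction n with
    | zero => simp
    | succ n ih => rw [pow_succ, pow_mul, ih, hV]
  have h2 : mu p V α ^ p ^ (-t).val = 0 := by
    unfold mu
    rw [sum_pow_char_pow, ← h1]
    apply Finset.sum_congr rfl
    intro x _
    rw [mul_pow, hVn]
    congr 1
    unfold ev
    rw [← Finset.prod_pow]
    apply Finset.prod_congr rfl
    intro i _
    rw [← Finset.prod_pow, ← Finset.prod_pow_eq_pow_sum]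
    apply Finset.prod_congr rfl
    intro u _
    have h3 : (((u.val + (-t).val : ℕ) : ZMod f)) = u - t := by
      push_cast
      rw [ZMod.natCast_zmod_val, ZMod.natCast_zmod_val]; ring
    have h4 := pow_val hq (x i) (u.val + (-t).val)
    rw [h3] at h4
    rw [mul_comm (α i u), pow_mul, h4, pow_add, pow_mul, pow_right_comm]
  exact pow_eq_zero_iff (pow_ne_zero _ hp.ne_zero) |>.1 h2

lemma exists_mu (V : (Fin m → K) → K) (z : Fin m → K) (hz : V z ≠ 0) :
    ∃ α : Fin m → ZMod f → ℕ, mu p V α ≠ 0 := by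
  classical
  by_contra! hcon
  have h1 : ∀ P : MvPolynomial (Fin m) K, ∑ x, V x * MvPolynomial.eval x P = 0 := by
    intro P
    induction P using MvPolynomial.induction_on' with
    | monomial E c =>
      have := hcon (fun i => Pi.single 0 (E i))
      have h2 : ∑ x, V x * MvPolynomial.eval x (MvPolynomial.monomial E c) = c * mu p V (f := f) (fun i => Pi.single 0 (E i)) := by
        unfold mu
        rw [Finset.mul_sum]
        apply Finset.sum_congr rfl
        intro x _
        rw [MvPolynomial.eval_monomial]
        have : ev p (fun i => (Pi.single 0 (E i) : ZMod f → ℕ)) x = ∏ i, x i ^ E i := by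
          unfold ev
          apply Finset.prod_congr rfl
          intro i _
          rw [Finset.prod_eq_single 0]
          · simp
          · intro b _ hb; simp [hb]
          · simp
        rw [this, Finsupp.prod_fintype _ _ (by simp)]
        ring
      rw [h2, this, mul_zero]
    | add P Q hP hQ => simp only [map_add, mul_add, Finset.sum_add_distrib, hP, hQ, add_zero]
  have h2 := h1 (MvPolynomial.indicator z)
  rw [Finset.sum_eq_single z] at h2
  · rw [MvPolynomial.eval_indicator_apply_eq_one, mul_one] at h2
    exact hz h2
  · intro b _ hb
    rw [MvPolynomial.eval_indicator_apply_eq_zero _ _ hb, mul_zero]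
  · simp

/-- extremal choice -/
lemma exists_extremal (V : (Fin m → K) → K) (h : ∃ α : Fin m → ZMod f → ℕ, mu p V α ≠ 0) :
    ∃ (G : ℕ) (α : Fin m → ZMod f → ℕ), mu p V α ≠ 0 ∧ (∀ t, ww p t α ≤ G) ∧
      (∀ α' : Fin m → ZMod f → ℕ, (∀ t, ww p t α' < G) → mu p V α' = 0) ∧
      (∀ α' : Fin m → ZMod f → ℕ, mu p V α' ≠ 0 → (∀ t, ww p t α' ≤ G) →
        ∑ t, ww p t α' ≤ ∑ t, ww p t α) := by
  classical
  have h1 : ∃ G, ∃ α : Fin m → ZMod f → ℕ, mu p V α ≠ 0 ∧ ∀ t, ww p t α ≤ G := by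
    obtain ⟨α, hα⟩ := h
    exact ⟨∑ t, ww p t α, α, hα, fun t =>
      Finset.single_le_sum (f := fun t => ww p t α) (fun _ _ => Nat.zero_le _) (Finset.mem_univ t)⟩
  have hG := Nat.find_spec h1
  set G := Nat.find h1 with hGdef
  have hb : ∀ α : Fin m → ZMod f → ℕ, (∀ t, ww p t α ≤ G) →
      ∑ t, ww p t α ≤ Fintype.card (ZMod f) * G := by
    intro α hα
    calc _ ≤ ∑ t : ZMod f, G := Finset.sum_le_sum (fun t _ => hα t)
      _ = _ := by simp
  have h2 : ∃ r, ∃ α : Fin m → ZMod f → ℕ, (mu p V α ≠ 0 ∧ ∀ t, ww p t α ≤ G) ∧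
      Fintype.card (ZMod f) * G - ∑ t, ww p t α = r := by
    obtain ⟨α, hα⟩ := hG
    exact ⟨_, α, hα, rfl⟩
  obtain ⟨α, ⟨hα1, hα2⟩, hr⟩ := Nat.find_spec h2
  refine ⟨G, α, hα1, hα2, ?_, ?_⟩
  · intro α' hα'
    by_contra hne
    have hpos : 0 < G := lt_of_le_of_lt (Nat.zero_le _) (hα' 0)
    refine Nat.find_min h1 (m := G - 1) (by omega) ⟨α', hne, fun t => ?_⟩
    have := hα' t
    omega
  · intro α' hne hle
    have h3 := Nat.find_min' h2 ⟨α', ⟨hne, hle⟩, rfl⟩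
    rw [← hr] at h3
    have := hb α hα2
    have := hb α' hle
    omega

/-- all weights of an extremal pattern are large -/
lemma extremal_large (hp : p.Prime) (hq : Fintype.card K = p ^ f) (V : (Fin m → K) → K)
    (α : Fin m → ZMod f → ℕ) (G : ℕ) (hα : mu p V α ≠ 0)
    (hlow : ∀ t, p ^ f - 1 ≤ ww p t α) (hG : ∀ t, ww p t α ≤ G)
    (hmax : ∀ α' : Fin m → ZMod f → ℕ, mu p V α' ≠ 0 → (∀ t, ww p t α' ≤ G) →
        ∑ t, ww p t α' ≤ ∑ t, ww p t α) (s : ZMod f) : G < ww p s α + (p ^ f - 1) := by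
  have hq2 : 2 ≤ p ^ f := by
    calc 2 ≤ p := hp.two_le
      _ = p ^ 1 := (pow_one p).symm
      _ ≤ p ^ f := Nat.pow_le_pow_right hp.pos (Nat.one_le_iff_ne_zero.2 (NeZero.ne f))
  by_contra hcon
  push Not at hcon
  obtain ⟨s0, _, hs0⟩ := Finset.exists_min_image Finset.univ (fun t => ww p t α) ⟨s, Finset.mem_univ _⟩
  have hs0' : ww p s0 α + (p ^ f - 1) ≤ G := by
    have := hs0 s (Finset.mem_univ _)
    omega
  have hsh := ww_shift (p := p) hp.one_le s0 α
  have h1 : 0 < ∑ i, α i s0 := by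
    rcases Nat.eq_zero_or_pos (∑ i, α i s0) with h0 | h0
    · exfalso
      rw [h0, mul_zero, add_zero] at hsh
      have h2 := hs0 (s0+1) (Finset.mem_univ _)
      have h3 := hlow s0
      have h4 := hp.two_le
      have h5 : 1 ≤ ww p s0 α := by omega
      have h6 := Nat.mul_le_mul h4 h2
      omega
    · exact h0
  obtain ⟨i, _, hi⟩ := Finset.exists_ne_zero_of_sum_ne_zero h1.ne'
  set γ : Fin m → ZMod f → ℕ := α - Pi.single i (Pi.single s0 1) with hγ
  have hαγ : α = γ + Pi.single i (Pi.single s0 1) := by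
    rw [hγ]
    ext i' u'
    simp only [Pi.add_apply, Pi.sub_apply]
    by_cases h2 : i' = i
    · subst h2
      by_cases h3 : u' = s0
      · subst h3; simp; omega
      · simp [h3]
    · simp [h2]
  set α' : Fin m → ZMod f → ℕ := γ + Pi.single i (Pi.single (s0 - 1) p) with hα'
  have hval := val_pred (f := f)
  have hev : ∀ x : Fin m → K, ev p α' x = ev p α x := by
    intro x
    rw [hα', hαγ, ev_add, ev_add, ev_single, ev_single]
    congr 1
    rw [pow_one, ← pow_mul, ← pow_succ]
    have h3 : (((s0 - 1).val + 1 : ℕ) : ZMod f) = s0 := by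
      push_cast
      rw [ZMod.natCast_zmod_val]; ring
    have := pow_val hq (x i) ((s0 - 1).val + 1)
    rw [h3] at this
    exact this.symm
  have hmu : mu p V α' = mu p V α := by
    unfold mu
    simp_rw [hev]
  have hwt : ∀ t, ww p t α' = ww p t α + if t = s0 then p ^ f - 1 else 0 := by
    intro t
    rw [hα', hαγ, ww_add, ww_add, ww_single, ww_single]
    rw [show p * p ^ (s0 - 1 - t).val = p ^ ((s0 - t - 1).val + 1) by
      rw [pow_succ, mul_comm, show s0 - 1 - t = s0 - t - 1 by ring]]
    rw [hval]
    by_cases ht : t = s0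
    · subst ht
      simp
      omega
    · rw [if_neg (sub_ne_zero.2 (Ne.symm ht)), if_neg ht]; ring
  have := hmax α' (by rw [hmu]; exact hα) (by
    intro t
    rw [hwt]
    split_ifs with ht
    · subst ht; exact hs0'
    · exact hG t)
  simp_rw [hwt, Finset.sum_add_distrib] at this
  simp at this
  omega

lemma sigma_large {p Q G w w' σ : ℕ} (hp : 2 ≤ p) (hsh : p * w' = w + Q * σ) (hw : w ≤ G)
    (hw' : Q ≤ w') (hG : G < w' + Q) : p - 1 ≤ σ := by
  by_contra hcon
  obtain ⟨c, rfl⟩ := Nat.exists_eq_add_of_le hp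
  have h1 : σ ≤ c := by omega
  have h2 := Nat.mul_le_mul_left Q h1
  rcases le_or_gt (2 * Q) G with h | h <;> nlinarith

lemma expand (hp : p.Prime) [CharP K p] (hq : Fintype.card K = p ^ f) (c X : Option (Fin m) → K) :
    (∑ o, c o * X o) ^ (Fintype.card K - 1) =
      ∑ B ∈ Fintype.piFinset (fun _ : ZMod f => piAntidiag (univ : Finset (Option (Fin m))) (p - 1)),
        ((∏ u, (Nat.multinomial univ (B u) : K)) * ∏ u, ∏ o, (c o ^ p ^ u.val) ^ B u o) *
          ∏ u, ∏ o, (X o ^ p ^ u.val) ^ B u o := by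
  have : Fact p.Prime := ⟨hp⟩
  rw [hq, ← sum_pow_val (f := f) hp.one_le, ← Finset.prod_pow_eq_pow_sum]
  have h1 : ∀ u : ZMod f, (∑ o, c o * X o) ^ ((p - 1) * p ^ u.val) =
      ∑ k ∈ piAntidiag (univ : Finset (Option (Fin m))) (p - 1),
        (Nat.multinomial univ k : K) * ∏ o, ((c o * X o) ^ p ^ u.val) ^ k o := by
    intro u
    rw [mul_comm, pow_mul, sum_pow_char_pow, Finset.sum_pow_eq_sum_piAntidiag]
  simp_rw [h1]
  rw [Finset.prod_univ_sum]
  apply Finset.sum_congr rfl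
  intro B _
  rw [mul_assoc, ← Finset.prod_mul_distrib, ← Finset.prod_mul_distrib]
  apply Finset.prod_congr rfl
  intro u _
  rw [← Finset.prod_mul_distrib]
  congr 1
  apply Finset.prod_congr rfl
  intro o _
  rw [mul_pow, mul_pow]

lemma multinomial_ne_zero (hp : p.Prime) [CharP K p] {ι : Type*} [Fintype ι] (k : ι → ℕ)
    (hk : ∑ i, k i = p - 1) : (Nat.multinomial univ k : K) ≠ 0 := by
  intro h0
  rw [CharP.cast_eq_zero_iff K p] at h0
  have h1 := Nat.multinomial_spec univ k
  rw [hk] at h1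
  have h2 : p ∣ (p - 1).factorial := by rw [← h1]; exact Dvd.dvd.mul_left h0 _
  have := (hp.dvd_factorial).1 h2
  have := hp.one_le
  omega

theorem core (hp : p.Prime) [CharP K p] (hq : Fintype.card K = p ^ f) (V : (Fin m → K) → K)
    (hV : ∀ x, V x ^ p = V x)
    (H1 : ∀ E : Fin m → ℕ, ∑ i, E i < Fintype.card K - 1 → ∑ x, V x * ∏ i, x i ^ E i = 0)
    (H2 : ∀ β : Fin m → K, β ≠ 0 → ∃ a, ∀ x, ∑ i, β i * x i = a → V x = 0) :
    ∀ x, V x = 0 := by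
  classical
  by_contra! hcon
  obtain ⟨z, hz⟩ := hcon
  obtain ⟨G, α, hα, hαG, hmin, hmax⟩ := exists_extremal V (exists_mu (p := p) (f := f) V z hz)
  have hlow := mu_ne_zero hp hq V hV H1 α hα
  have hlarge := extremal_large hp hq V α G hα hlow hαG hmax
  have hq2 : 2 ≤ p ^ f := by rw [← hq]; exact Fintype.one_lt_card
  have hσ : ∀ u, p - 1 ≤ ∑ i, α i u := fun u =>
    sigma_large hp.two_le (ww_shift hp.one_le u α) (hαG u) (hlow (u+1)) (hlarge (u+1))
  choose b hbα hbs using fun u => exists_sub_sum (fun i => α i u) (p - 1) (hσ u)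
  set b' : Fin m → ZMod f → ℕ := fun i u => b u i with hb'
  set τ : Fin m → ZMod f → ℕ := α - b' with hτ
  have hατ : α = τ + b' := by
    ext i u
    simp only [hτ, hb', Pi.add_apply, Pi.sub_apply]
    have := hbα u i
    omega
  have hwb : ∀ t, ww p t b' = p ^ f - 1 := by
    intro t
    unfold ww
    rw [Finset.sum_comm, ← sum_pow_val' hp.one_le t]
    apply Finset.sum_congr rfl
    intro u _
    rw [← Finset.sum_mul, ← hbs u]
  have hwτ : ∀ t, ww p t τ + (p ^ f - 1) ≤ G := by
    intro t
    rw [← hwb t, ← ww_add, ← hατ]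
    exact hαG t
  have hμτ : mu p V τ = 0 := hmin τ (fun t => by have := hwτ t; omega)
  have H2' : ∀ β : Fin m → K, ∃ a, ∀ x, ∑ i, β i * x i = a → V x = 0 := by
    intro β
    by_cases hβ : β = 0
    · refine ⟨1, fun x hx => ?_⟩
      subst hβ
      simp at hx
    · exact H2 β hβ
  -- the index set
  set I := Fintype.piFinset (fun _ : ZMod f => piAntidiag (univ : Finset (Option (Fin m))) (p - 1)) with hI
  have hIsum : ∀ B ∈ I, ∀ u, ∑ o, B u o = p - 1 := by
    intro B hB u
    rw [hI, Fintype.mem_piFinset] at hB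
    exact (Finset.mem_piAntidiag.1 (hB u)).1
  let r : (ZMod f → Option (Fin m) → ℕ) → (Fin m → ZMod f → ℕ) := fun B i u => B u (some i)
  have hr : ∀ B ∈ I, ∀ t, ww p t (r B) + ∑ u, B u none * p ^ (u - t).val = p ^ f - 1 := by
    intro B hB t
    unfold ww
    rw [Finset.sum_comm, ← sum_pow_val' hp.one_le t, ← Finset.sum_add_distrib]
    apply Finset.sum_congr rfl
    intro u _
    rw [← hIsum B hB u, Fintype.sum_option, add_mul, Finset.sum_mul, add_comm]
  have hbad : ∀ B ∈ I, (∃ u, B u none ≠ 0) → mu p V (τ + r B) = 0 := by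
    rintro B hB ⟨u, hu⟩
    apply hmin
    intro t
    rw [ww_add]
    have h1 := hr B hB t
    have h2 := hwτ t
    have h3 : 0 < ∑ u, B u none * p ^ (u - t).val := by
      apply Finset.sum_pos'
      · intro _ _; exact Nat.zero_le _
      · exact ⟨u, Finset.mem_univ _, Nat.mul_pos (Nat.pos_of_ne_zero hu) (pow_pos hp.pos _)⟩
    omega
  let M : (ZMod f → Option (Fin m) → ℕ) → K := fun B => ∏ u, (Nat.multinomial univ (B u) : K)
  let ex : (ZMod f → Option (Fin m) → ℕ) → (Fin m →₀ ℕ) := fun B =>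
    Finsupp.equivFunOnFinite.symm (fun i => ∑ u, B u (some i) * p ^ u.val)
  have main : ∀ β : Fin m → K, ∑ B ∈ I, (M B * mu p V (τ + r B)) * ∏ i, β i ^ (ex B i) = 0 := by
    intro β
    obtain ⟨a, ha⟩ := H2' β
    have e1 : ∑ x, V x * ev p τ x * (∑ i, β i * x i - a) ^ (Fintype.card K - 1) = 0 := by
      rw [← hμτ]
      unfold mu
      apply Finset.sum_congr rfl
      intro x _
      by_cases hx : ∑ i, β i * x i = a
      · rw [ha x hx]; ring
      · rw [FiniteField.pow_card_sub_one_eq_one _ (sub_ne_zero.2 hx), mul_one]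
    let c : Option (Fin m) → K := fun o => o.elim (-a) β
    let X : (Fin m → K) → Option (Fin m) → K := fun x o => o.elim 1 x
    have e2 : ∀ x : Fin m → K, ∑ i, β i * x i - a = ∑ o, c o * X x o := by
      intro x
      rw [Fintype.sum_option]
      simp only [c, X, Option.elim]
      ring
    have e3 : ∀ (B : ZMod f → Option (Fin m) → ℕ) (x : Fin m → K),
        ∏ u, ∏ o, (X x o ^ p ^ u.val) ^ B u o = ev p (r B) x := by
      intro B x
      unfold ev
      rw [Finset.prod_comm (s := (univ : Finset (Fin m)))]
      apply Finset.prod_congr rfl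
      intro u _
      rw [Fintype.prod_option]
      simp [X, r]
    simp_rw [e2, expand (f := f) hp hq, e3, Finset.mul_sum] at e1
    rw [Finset.sum_comm] at e1
    rw [← e1]
    apply Finset.sum_congr rfl
    intro B hB
    by_cases hbB : ∃ u, B u none ≠ 0
    · have e4 : ∑ x, V x * ev p τ x * (((∏ u, (Nat.multinomial univ (B u) : K)) *
          ∏ u, ∏ o, (c o ^ p ^ u.val) ^ B u o) * ev p (r B) x)
          = ((∏ u, (Nat.multinomial univ (B u) : K)) * ∏ u, ∏ o, (c o ^ p ^ u.val) ^ B u o) *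
            mu p V (τ + r B) := by
        unfold mu
        rw [Finset.mul_sum]
        apply Finset.sum_congr rfl
        intro x _
        rw [ev_add]; ring
      rw [e4, hbad B hB hbB]; ring
    · push Not at hbB
      have e5 : ∏ u, ∏ o, (c o ^ p ^ u.val) ^ B u o = ∏ i, β i ^ (ex B i) := by
        have : ∀ i, β i ^ (ex B i) = ∏ u, (β i ^ p ^ u.val) ^ B u (some i) := by
          intro i
          simp only [ex, Finsupp.equivFunOnFinite_symm_apply_apply]
          rw [← Finset.prod_pow_eq_pow_sum]
          apply Finset.prod_congr rfl
          intro u _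
          rw [mul_comm, pow_mul]
        simp_rw [this]
        rw [Finset.prod_comm (s := (univ : Finset (Fin m)))]
        apply Finset.prod_congr rfl
        intro u _
        rw [Fintype.prod_option, hbB u]
        simp [c]
      rw [e5]
      unfold mu
      rw [Finset.mul_sum, Finset.sum_mul]
      apply Finset.sum_congr rfl
      intro x _
      rw [ev_add]; ring
  let R : MvPolynomial (Fin m) K := ∑ B ∈ I, MvPolynomial.monomial (ex B) (M B * mu p V (τ + r B))
  have hBle : ∀ B ∈ I, ∀ u o, B u o ≤ p - 1 := by
    intro B hB u o
    rw [← hIsum B hB u]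
    exact Finset.single_le_sum (f := fun o => B u o) (fun _ _ => Nat.zero_le _) (Finset.mem_univ o)
  have hR : R = 0 := by
    apply MvPolynomial.eq_zero_of_eval_zero_at_prod_finset R (fun _ => (univ : Finset K))
    rotate_left
    · intro β _
      rw [← main β]
      simp only [R, map_sum, MvPolynomial.eval_monomial]
      apply Finset.sum_congr rfl
      intro B _
      rw [Finsupp.prod_fintype _ _ (by simp)]
    · intro i
      rw [Finset.card_univ]
      have hlt : 0 < Fintype.card K := Fintype.card_pos
      suffices R.degreeOf i ≤ Fintype.card K - 1 by omega
      refine (MvPolynomial.degreeOf_sum_le i I _).trans ?_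
      apply Finset.sup_le
      intro B hB
      rw [MvPolynomial.degreeOf_le_iff]
      intro s hs
      have hs' := MvPolynomial.support_monomial_subset hs
      rw [Finset.mem_singleton] at hs'
      rw [hs', hq, ← sum_pow_val (f := f) hp.one_le]
      simp only [ex, Finsupp.equivFunOnFinite_symm_apply_apply]
      apply Finset.sum_le_sum
      intro u _
      exact Nat.mul_le_mul_right _ (hBle B hB u _)
  let b0 : ZMod f → Option (Fin m) → ℕ := fun u o => o.elim 0 (b u)
  have hb0s : ∀ u, ∑ o, b0 u o = p - 1 := by
    intro u
    rw [Fintype.sum_option]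
    simp [b0, hbs u]
  have hb0 : b0 ∈ I := by
    rw [hI, Fintype.mem_piFinset]
    intro u
    rw [Finset.mem_piAntidiag]
    exact ⟨hb0s u, fun _ _ => Finset.mem_univ _⟩
  have hcoef := congrArg (MvPolynomial.coeff (ex b0)) hR
  simp only [R, MvPolynomial.coeff_sum, MvPolynomial.coeff_monomial, MvPolynomial.coeff_zero] at hcoef
  rw [Finset.sum_eq_single b0] at hcoef
  · rw [if_pos rfl] at hcoef
    have hrb : τ + r b0 = α := by
      rw [hατ]; rfl
    rw [hrb] at hcoef
    rcases mul_eq_zero.1 hcoef with h0 | h0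
    · rw [Finset.prod_eq_zero_iff] at h0
      obtain ⟨u, _, hu⟩ := h0
      exact multinomial_ne_zero hp _ (hb0s u) hu
    · exact hα h0
  · intro B hB hne
    split_ifs with hex
    · have hbB : ∃ u, B u none ≠ 0 := by
        by_contra! hbB
        apply hne
        have h1 : ∀ i, (fun u => B u (some i)) = fun u => b0 u (some i) := by
          intro i
          have h2 := DFunLike.congr_fun hex i
          simp only [ex, Finsupp.equivFunOnFinite_symm_apply_apply] at h2
          have hpp := hp.one_le
          apply digits_inj (p := p) _ _ _ _ h2
          · intro u; have := hBle B hB u (some i); omega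
          · intro u; have := hBle b0 hb0 u (some i); omega
        ext u o
        cases o with
        | none => rw [hbB u]; rfl
        | some i => exact congrFun (h1 i) u
      rw [hbad B hB hbB, mul_zero]
    · rfl
  · intro h; exact absurd hb0 h

end Core
end Grie

namespace Grie
section Main
open Finset
variable {F : Type*} [Field F] [Fintype F] {n : ℕ}

theorem main_div {p f : ℕ} (hp : p.Prime) (hf : 1 ≤ f) (hq : Fintype.card F = p ^ f) (e : ℕ) :
    ∀ (k : ℕ) (C : Submodule F (Fin n → F)) (S : Finset (Fin n)) (d : ℕ),
      Module.finrank F C = k → Gr C S d → Fintype.card F ^ e ∣ d → ∀ c ∈ C, p ^ e ∣ wS S c := by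
  classical
  have : Fact p.Prime := ⟨hp⟩
  have : CharP F p := charP_of_card_eq_prime_pow hq
  have : NeZero f := ⟨by omega⟩
  induction e with
  | zero => intro k C S d _ _ _ c _; simp
  | succ e ihe =>
    intro k
    induction k with
    | zero =>
      intro C S d hk _ _ c hc
      have hC : C = ⊥ := Submodule.finrank_eq_zero.1 hk
      rw [hC, Submodule.mem_bot] at hc
      subst hc
      rw [wS_eq_sum]
      simp
    | succ k ihk =>
      intro C S d hk hG hd x hx
      by_cases hke : k ≤ e + 1
      · obtain ⟨T, hTC, hTf, hT⟩ := hG.exists_T k ((pow_dvd_pow _ hke).trans hd) (by omega)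
        have hTe : T = C := Submodule.eq_of_le_of_finrank_eq hTC (by omega)
        by_cases hx0 : x = 0
        · subst hx0
          rw [wS_eq_sum]
          simp
        · rw [hT x (by rw [hTe]; exact hx) hx0]
          refine dvd_trans ?_ hd
          rw [hq, ← pow_mul]
          apply pow_dvd_pow
          nlinarith
      · obtain ⟨T, hTC, hTf, hT⟩ := hG.exists_T (e+1) hd (by omega)
        let t : Module.Basis (Fin (e + 1 + 1)) F T := Module.finBasisOfFinrankEq F T hTf
        have hz : ∀ y : Fin (e + 1 + 1) → F, x + ∑ i, y i • (t i : Fin n → F) ∈ C := by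
          intro y
          apply C.add_mem hx
          apply Submodule.sum_mem
          intro i _
          exact C.smul_mem _ (hTC (t i).2)
        have hdiv : ∀ y : Fin (e + 1 + 1) → F, p ^ e ∣ wS S (x + ∑ i, y i • (t i : Fin n → F)) := by
          intro y
          exact ihe (k+1) C S d hk hG ((pow_dvd_pow _ (Nat.le_succ e)).trans hd) _ (hz y)
        choose V hV using hdiv
        have hcore := core (f := f) hp hq (fun y => (V y : F)) (by
            intro y
            exact map_natCast (frobenius F p) (V y)) (by
            intro E hE
            apply moment hf hq (e := e) le_rfl S (fun j => x j) (fun j i => (t i : Fin n → F) j) V _ E hE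
            intro y
            rw [← hV y, wS]
            congr 1
            apply Finset.filter_congr
            intro j _
            simp only [Pi.add_apply, Finset.sum_apply, Pi.smul_apply, smul_eq_mul, mul_comm]) (by
            intro β hβ
            let βl : T →ₗ[F] F := t.constr F β
            have hβt : ∀ i, βl (t i) = β i := fun i => t.constr_basis F β i
            have hβl : βl ≠ 0 := by
              intro h0
              apply hβ
              ext i
              rw [← hβt i, h0]; rfl
            obtain ⟨l, H, S', hl, hlH, hHf, hHG, hHw⟩ := hG.exists_hyper hTC hTf hT βl hβl
            refine ⟨- l ⟨x, hx⟩, fun y hy => ?_⟩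
            have hl0 : l ⟨_, hz y⟩ = 0 := by
              have e1 : (⟨_, hz y⟩ : C) = ⟨x, hx⟩ + ∑ i, y i • (⟨t i, hTC (t i).2⟩ : C) := by
                ext1
                simp
              rw [e1, map_add, map_sum]
              simp_rw [map_smul, hl, hβt, smul_eq_mul, mul_comm (y _)]
              rw [hy]; ring
            have hmem := hlH _ hl0
            have hdv := ihk H S' d (by omega) hHG hd _ hmem
            rw [hHw _ hmem] at hdv
            simp only at hdv
            rw [hV y, pow_succ] at hdv
            have := (Nat.mul_dvd_mul_iff_left (pow_pos hp.pos e)).1 hdv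
            exact (CharP.cast_eq_zero_iff F p _).2 this)
        have h0 := hcore 0
        have h1 := (CharP.cast_eq_zero_iff F p _).1 h0
        have h2 := hV 0
        simp only [Pi.zero_apply, zero_smul, Finset.sum_const_zero, add_zero] at h2
        rw [h2, pow_succ]
        exact Nat.mul_dvd_mul_left _ h1

end Main
end Grie

theorem stmt17 {F : Type*} [Field F] [Fintype F] {n k d e p f : ℕ}
    (hp : p.Prime) (hf : 1 ≤ f) (hq : Fintype.card F = p ^ f)
    (C : Submodule F (Fin n → F))
    (hk : Module.finrank F C = k)
    (hn : n = gbound (Fintype.card F) k d)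
    (hmin : ∀ c ∈ C, c ≠ 0 → d ≤ wt c)
    (hex : ∃ c ∈ C, c ≠ 0 ∧ wt c = d)
    (hd : Fintype.card F ^ e ∣ d) :
    ∀ c ∈ C, p ^ e ∣ wt c := by
  have hG : Grie.Gr C Finset.univ d := by
    refine ⟨?_, ?_, ?_⟩
    · obtain ⟨c, _, hc0, hcw⟩ := hex
      rw [← hcw]
      obtain ⟨i, hi⟩ := Function.ne_iff.1 hc0
      have : Nonempty {i // c i ≠ 0} := ⟨⟨i, hi⟩⟩
      exact Nat.card_pos
    · intro x hx hx0
      rw [Grie.wS_univ]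
      exact hmin x hx hx0
    · rw [Finset.card_univ, Fintype.card_fin, hk]
      exact hn.le
  intro c hc
  rw [← Grie.wS_univ]
  exact Grie.main_div hp hf hq e k C Finset.univ d hk hG hd c hc
end

section
/- Let C be a Griesmer [g_q(k,d),k,d] code over F_q with q = p^f, p prime. If p^e divides d, then ⌈p^{e−(f−1)(q−2)}⌉ divides the weight of every codeword of C. -/
namespace G18
set_option linter.unusedSectionVars false
set_option linter.unusedSimpArgs false
open Finset
section Alg
variable {F : Type*} [Field F] [Fintype F] {V : Type*} [AddCommGroup V] [Module F V]

/-- group-like element -/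
noncomputable def X (F : Type*) [Field F] {V : Type*} [AddCommGroup V] (u : V) : AddMonoidAlgebra F V :=
  AddMonoidAlgebra.single u (1 : F)

/-- unmodified divided power -/
noncomputable def raw (F : Type*) [Field F] [Fintype F] {V : Type*} [AddCommGroup V] [Module F V]
    (j : ℕ) (v : V) : AddMonoidAlgebra F V :=
  -∑ a : F, a ^ (Fintype.card F - 1 - j) • X F (a • v)

/-- divided power -/
noncomputable def th (F : Type*) [Field F] [Fintype F] {V : Type*} [AddCommGroup V] [Module F V]
    (j : ℕ) (v : V) : AddMonoidAlgebra F V :=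
  if j = 0 then 1 else raw F j v

lemma X_add (u v : V) : X F (u + v) = X F u * X F v := by
  simp [X, AddMonoidAlgebra.single_mul_single]

lemma X_zero : X F (0 : V) = 1 := by
  simp [X, AddMonoidAlgebra.one_def]


lemma th_zero (v : V) : th F 0 v = 1 := by simp [th]

lemma th_pos {j : ℕ} (hj : 1 ≤ j) (v : V) : th F j v = raw F j v := by
  rw [th, if_neg (by omega)]

lemma two_le_card : 2 ≤ Fintype.card F := Fintype.one_lt_card

lemma card_cast : (Fintype.card F : F) = 0 := FiniteField.cast_card_eq_zero F

lemma sum_pow_top : ∑ a : F, a ^ (Fintype.card F - 1) = -1 := by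
  classical
  have h : ∀ a : F, a ^ (Fintype.card F - 1) = 1 - if a = 0 then 1 else 0 := by
    intro a
    split_ifs with h
    · subst h
      rw [zero_pow (by have := two_le_card (F := F); omega)]; simp
    · rw [FiniteField.pow_card_sub_one_eq_one a h]; simp
  simp only [h, sum_sub_distrib]
  simp [card_cast]

lemma delta {i k : ℕ} (hi : 1 ≤ i) (hi' : i ≤ Fintype.card F - 1) (hk : k ≤ Fintype.card F - 1) :
    ∑ a : F, a ^ (Fintype.card F - 1 - i) * a ^ k = if k = i then -1 else 0 := by
  have h2 := two_le_card (F := F)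
  simp only [← pow_add]
  rcases lt_trichotomy k i with h | h | h
  · rw [if_neg (by omega)]
    exact FiniteField.sum_pow_lt_card_sub_one F _ (by omega)
  · rw [if_pos h, ← sum_pow_top]
    congr; ext a; congr 1; omega
  · rw [if_neg (by omega)]
    rw [← FiniteField.sum_pow_lt_card_sub_one F (k - i) (by omega)]
    refine sum_congr rfl fun a _ => ?_
    have : Fintype.card F - 1 - i + k = Fintype.card F + (k - i - 1) := by omega
    rw [this, pow_add, FiniteField.pow_card, ← pow_succ']
    congr 1; omega

lemma raw_zero (v : V) : raw F 0 v = 1 + th F (Fintype.card F - 1) v := by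
  classical
  have h2 := two_le_card (F := F)
  rw [th_pos (by omega)]
  simp only [raw, Nat.sub_zero, Nat.sub_self, pow_zero, one_smul]
  have h : ∀ a : F, a ^ (Fintype.card F - 1) = 1 - if a = 0 then 1 else 0 := by
    intro a
    split_ifs with h
    · subst h
      rw [zero_pow (by omega)]; simp
    · rw [FiniteField.pow_card_sub_one_eq_one a h]; simp
  simp only [h, sub_smul, sum_sub_distrib, one_smul, ite_smul, zero_smul]
  simp [X_zero, sub_eq_add_neg]

lemma geo (a b : F) [DecidableEq F] :
    ∑ j ∈ range (Fintype.card F), a ^ j * b ^ (Fintype.card F - 1 - j) = if a = b then 0 else 1 := by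
  have h2 := two_le_card (F := F)
  split_ifs with h
  · subst h
    have : ∀ j ∈ range (Fintype.card F), a ^ j * a ^ (Fintype.card F - 1 - j) = a ^ (Fintype.card F - 1) := by
      intro j hj
      rw [← pow_add]; congr 1
      have := mem_range.1 hj; omega
    rw [sum_congr rfl this]
    simp [card_cast]
  · have := Commute.geom_sum₂_mul (Commute.all a b) (Fintype.card F)
    rw [FiniteField.pow_card, FiniteField.pow_card] at this
    exact mul_right_cancel₀ (sub_ne_zero.2 h) (by rw [this, one_mul])

lemma X_smul (a : F) (v : V) :
    X F (a • v) = ∑ j ∈ range (Fintype.card F), a ^ j • th F j v := by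
  classical
  have h2 := two_le_card (F := F)
  have e1 : ∑ j ∈ range (Fintype.card F), a ^ j • th F j v
      = ∑ j ∈ range (Fintype.card F), a ^ j • raw F j v - th F (Fintype.card F - 1) v := by
    obtain ⟨n, hn⟩ : ∃ n, Fintype.card F = n + 1 := ⟨Fintype.card F - 1, by omega⟩
    simp only [hn]
    rw [sum_range_succ', sum_range_succ']
    have hr := raw_zero (F := F) v
    rw [hn] at hr
    simp only [pow_zero, one_smul, th_zero, hr, th_pos (F := F) (Nat.le_add_left 1 _)]
    abel
  rw [e1]
  have e2 : ∑ j ∈ range (Fintype.card F), a ^ j • raw F j v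
      = - ∑ b : F, (∑ j ∈ range (Fintype.card F), a ^ j * b ^ (Fintype.card F - 1 - j)) • X F (b • v) := by
    simp only [raw, smul_neg, sum_neg_distrib, smul_sum, sum_smul, smul_smul]
    rw [sum_comm]
  rw [e2, th_pos (by omega)]
  simp only [geo, raw, Nat.sub_self, pow_zero, one_smul, ite_smul, zero_smul]
  have : ∀ b : F, (if a = b then (0 : AddMonoidAlgebra F V) else X F (b • v))
      = X F (b • v) - if a = b then X F (b • v) else 0 := by
    intro b; split_ifs <;> simp
  simp only [this, sum_sub_distrib]
  simp

lemma X_eq (v : V) : X F v = ∑ j ∈ range (Fintype.card F), th F j v := by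
  have := X_smul (1 : F) v
  simpa using this

lemma th_add_eq {j : ℕ} (hj : 1 ≤ j) (v w : V) :
    th F j (v + w) = ∑ i ∈ range (Fintype.card F), ∑ i' ∈ range (Fintype.card F),
      (-∑ a : F, a ^ (Fintype.card F - 1 - j + i + i')) • (th F i v * th F i' w) := by
  rw [th_pos hj, raw]
  simp only [smul_add, X_add, X_smul _ v, X_smul _ w, sum_mul_sum, smul_sum, neg_smul, sum_smul,
    sum_neg_distrib, smul_mul_smul_comm, smul_smul, ← pow_add, ← add_assoc]
  congr 1
  rw [sum_comm]
  refine sum_congr rfl fun i _ => ?_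
  rw [sum_comm]

lemma th_add_mem (S : Submodule F (AddMonoidAlgebra F V)) (y : AddMonoidAlgebra F V)
    {j : ℕ} (hj1 : j ≤ Fintype.card F - 1) (v w : V)
    (h : ∀ i i', i ≤ Fintype.card F - 1 → i' ≤ Fintype.card F - 1 → j ≤ i + i' →
      th F i v * th F i' w * y ∈ S) :
    th F j (v + w) * y ∈ S := by
  have h2 := two_le_card (F := F)
  rcases Nat.eq_zero_or_pos j with rfl | hj
  · have := h 0 0 (by omega) (by omega) (by omega)
    simpa [th_zero] using this
  rw [th_add_eq hj, sum_mul]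
  refine S.sum_mem fun i hi => ?_
  rw [sum_mul]
  refine S.sum_mem fun i' hi' => ?_
  rw [smul_mul_assoc]
  have := mem_range.1 hi
  have := mem_range.1 hi'
  by_cases hc : j ≤ i + i'
  · exact S.smul_mem _ (h i i' (by omega) (by omega) hc)
  · rw [FiniteField.sum_pow_lt_card_sub_one F _ (by omega)]
    simp

lemma th_smul {j : ℕ} (hj : j ≤ Fintype.card F - 1) (a : F) (v : V) :
    th F j (a • v) = a ^ j • th F j v := by
  classical
  have h2 := two_le_card (F := F)
  rcases Nat.eq_zero_or_pos j with rfl | hj0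
  · simp [th_zero]
  rw [th_pos hj0, raw]
  simp only [smul_smul, X_smul _ v, smul_sum]
  rw [sum_comm, ← sum_neg_distrib]
  rw [sum_eq_single j]
  · simp only [← sum_smul, ← neg_smul]
    congr 1
    have := delta (F := F) hj0 hj hj
    rw [if_pos rfl] at this
    simp only [mul_pow, ← mul_assoc, ← sum_mul]
    rw [this]; ring
  · intro k hk hkj
    simp only [← sum_smul, ← neg_smul]
    have := mem_range.1 hk
    have := delta (F := F) hj0 hj (k := k) (by omega)
    rw [if_neg hkj] at this
    simp only [mul_pow, ← mul_assoc, ← sum_mul]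
    rw [this]; simp
  · intro h; exact absurd (mem_range.2 (by omega)) h

lemma th_zero_vec {j : ℕ} (hj0 : 1 ≤ j) (hj : j ≤ Fintype.card F - 1) : th F j (0 : V) = 0 := by
  have := th_smul hj (0 : F) (0 : V)
  rw [zero_smul, zero_pow (by omega), zero_smul] at this
  exact this

lemma th_mul {i j : ℕ} (hij : i + j ≤ Fintype.card F - 1) (v : V) :
    th F i v * th F j v = ((i + j).choose i : F) • th F (i + j) v := by
  classical
  have h2 := two_le_card (F := F)
  rcases Nat.eq_zero_or_pos i with rfl | hi
  · simp [th_zero]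
  rcases Nat.eq_zero_or_pos j with rfl | hj
  · simp [th_zero]
  have key : ∀ M ∈ range (Fintype.card F),
      ∑ a : F, ∑ b : F, a ^ (Fintype.card F - 1 - i) * b ^ (Fintype.card F - 1 - j) * (a + b) ^ M
        = if M = i + j then ((i + j).choose i : F) else 0 := by
    intro M hM
    have hM := mem_range.1 hM
    have e1 : ∀ a b : F, a ^ (Fintype.card F - 1 - i) * b ^ (Fintype.card F - 1 - j) * (a + b) ^ M
        = ∑ k ∈ range (M + 1), (M.choose k : F) *
          ((a ^ (Fintype.card F - 1 - i) * a ^ k) * (b ^ (Fintype.card F - 1 - j) * b ^ (M - k))) := by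
      intro a b
      rw [add_pow, mul_sum]
      refine sum_congr rfl fun k _ => ?_
      ring
    have e2 : ∑ a : F, ∑ b : F, a ^ (Fintype.card F - 1 - i) * b ^ (Fintype.card F - 1 - j) * (a + b) ^ M
        = ∑ k ∈ range (M + 1), (M.choose k : F) *
          ((∑ a : F, a ^ (Fintype.card F - 1 - i) * a ^ k) *
            (∑ b : F, b ^ (Fintype.card F - 1 - j) * b ^ (M - k))) := by
      simp only [e1, sum_mul_sum]
      simp only [mul_sum]
      symm
      rw [sum_comm]
      refine sum_congr rfl fun a _ => ?_
      rw [sum_comm]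
    rw [e2]
    have e3 : ∀ k ∈ range (M + 1), (M.choose k : F) *
          ((∑ a : F, a ^ (Fintype.card F - 1 - i) * a ^ k) *
            (∑ b : F, b ^ (Fintype.card F - 1 - j) * b ^ (M - k)))
        = if k = i then (if M = i + j then ((i + j).choose i : F) else 0) else 0 := by
      intro k hk
      have hk := mem_range.1 hk
      rw [delta hi (by omega) (by omega), delta hj (by omega) (by omega)]
      by_cases h1 : k = i
      · subst h1
        by_cases h3 : M = k + j
        · subst h3; simp
        · have : M - k ≠ j := by omega
          simp [h3, this]
      · simp [h1]
    rw [sum_congr rfl e3, sum_ite_eq']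
    split_ifs with h1 h3 h3
    · rfl
    · rfl
    · exact absurd (mem_range.2 (by omega)) h1
    · rfl
  rw [th_pos hi, th_pos hj, raw, raw, neg_mul_neg, sum_mul_sum]
  simp only [smul_mul_smul_comm, ← X_add, ← add_smul]
  simp only [X_smul _ v, smul_sum, smul_smul]
  have : ∀ a : F, ∑ b : F, ∑ M ∈ range (Fintype.card F),
      (a ^ (Fintype.card F - 1 - i) * b ^ (Fintype.card F - 1 - j) * (a + b) ^ M) • th F M v
      = ∑ M ∈ range (Fintype.card F), ∑ b : F,
      (a ^ (Fintype.card F - 1 - i) * b ^ (Fintype.card F - 1 - j) * (a + b) ^ M) • th F M v :=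
    fun a => sum_comm
  simp only [this]
  rw [sum_comm]
  simp only [← sum_smul]
  rw [sum_congr rfl fun M hM => by rw [key M hM]]
  simp only [ite_smul, zero_smul]
  rw [sum_ite_eq', if_pos (mem_range.2 (by omega))]

lemma split_eq {i j : ℕ} (hj : 1 ≤ j) (hij : i + j ≤ Fintype.card F - 1) (c b : V) :
    -∑ a : F, a ^ (Fintype.card F - 1 - j) • th F (i + j) (c + a • b) = raw F i c * th F j b := by
  classical
  have h2 := two_le_card (F := F)
  have e1 : ∀ a : F, th F (i + j) (c + a • b)
      = ∑ k ∈ range (Fintype.card F), a ^ k • ((-∑ t : F, (t ^ (Fintype.card F - 1 - (i + j)) * t ^ k) • X F (t • c)) * th F k b) := by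
    intro a
    rw [th_pos (by omega), raw]
    simp only [smul_add, X_add, smul_smul, X_smul _ b, mul_sum, smul_sum, neg_mul, sum_mul, smul_neg,
      sum_neg_distrib]
    rw [sum_comm]
    congr 1
    refine sum_congr rfl fun k _ => sum_congr rfl fun t _ => ?_
    simp only [mul_smul_comm, smul_mul_assoc, smul_smul]
    congr 1
    ring
  simp only [e1, smul_sum, smul_smul]
  rw [sum_comm]
  simp only [← sum_smul]
  rw [sum_eq_single j]
  · rw [delta hj (by omega) (by omega), if_pos rfl, neg_one_smul, neg_neg, raw]
    congr 2
    refine sum_congr rfl fun t _ => ?_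
    rw [← pow_add]; congr 2; omega
  · intro k hk hkj
    have := mem_range.1 hk
    rw [delta hj (by omega) (by omega), if_neg hkj, zero_smul]
  · intro h; exact absurd (mem_range.2 (by omega)) h

lemma split_mem (S : Submodule F (AddMonoidAlgebra F V)) (y : AddMonoidAlgebra F V)
    {i j : ℕ} (hj : 1 ≤ j) (hij : i + j ≤ Fintype.card F - 1) (c b : V)
    (h1 : ∀ a : F, th F (i + j) (c + a • b) * y ∈ S)
    (h2 : th F (Fintype.card F - 1) c * th F j b * y ∈ S) :
    th F i c * th F j b * y ∈ S := by
  have h3 : raw F i c * th F j b * y ∈ S := by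
    rw [← split_eq hj hij, neg_mul, sum_mul]
    refine S.neg_mem (S.sum_mem fun a _ => ?_)
    rw [smul_mul_assoc]
    exact S.smul_mem _ (h1 a)
  rcases Nat.eq_zero_or_pos i with rfl | hi
  · rw [raw_zero] at h3
    rw [th_zero]
    have := S.sub_mem h3 h2
    convert this using 1
    ring
  · rwa [th_pos hi]

end Alg
end G18

namespace G18
open Finset
set_option linter.unusedSectionVars false
set_option linter.unusedSimpArgs false
section Ev
variable {F : Type*} [Field F] [Fintype F] {V : Type*} [AddCommGroup V] [Module F V]

/-- evaluation functional attached to `P` -/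
noncomputable def ev (P : V → F) : AddMonoidAlgebra F V →ₗ[F] F :=
  (Finsupp.linearCombination F P) ∘ₗ (AddMonoidAlgebra.coeffLinearEquiv F).toLinearMap

lemma ev_single (P : V → F) (u : V) (c : F) : ev P (AddMonoidAlgebra.single u c) = c * P u := by
  change Finsupp.linearCombination F P (Finsupp.single u c) = _
  simp

lemma ev_X (P : V → F) (u : V) : ev P (X F u) = P u := by
  rw [X, ev_single, one_mul]

lemma single_eq (u : V) (c : F) : AddMonoidAlgebra.single u c = c • X F u := by
  simp [X]

/-- The largest ideal in the kernel of `ev`. -/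
noncomputable def KK (P : V → F) : Submodule F (AddMonoidAlgebra F V) where
  carrier := {x | ∀ u, ev P (x * X F u) = 0}
  zero_mem' := by intro u; simp
  add_mem' := by
    intro x y hx hy u
    rw [add_mul, map_add, hx u, hy u, add_zero]
  smul_mem' := by
    intro c x hx u
    rw [smul_mul_assoc, map_smul, hx u, smul_zero]

lemma mem_KK {P : V → F} {x : AddMonoidAlgebra F V} : x ∈ KK P ↔ ∀ u, ev P (x * X F u) = 0 := Iff.rfl

lemma KK_mul {P : V → F} {x : AddMonoidAlgebra F V} (hx : x ∈ KK P) (y : AddMonoidAlgebra F V) :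
    x * y ∈ KK P := by
  intro u
  induction y using AddMonoidAlgebra.induction_linear with
  | zero => simp
  | add y z hy hz => rw [mul_add, add_mul, map_add, hy, hz, add_zero]
  | single v c =>
    rw [single_eq, mul_smul_comm, smul_mul_assoc, map_smul, mul_assoc, ← X_add, hx, smul_zero]

lemma KK_mul_left {P : V → F} {x : AddMonoidAlgebra F V} (hx : x ∈ KK P) (y : AddMonoidAlgebra F V) :
    y * x ∈ KK P := by rw [mul_comm]; exact KK_mul hx y

lemma KK_ev {P : V → F} {x : AddMonoidAlgebra F V} (hx : x ∈ KK P) : ev P x = 0 := by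
  have := hx 0
  rwa [X_zero, mul_one] at this

/-- product of a list of divided powers -/
noncomputable def Th (F : Type*) [Field F] [Fintype F] {V : Type*} [AddCommGroup V] [Module F V]
    (L : List (ℕ × V)) : AddMonoidAlgebra F V :=
  (L.map fun t => th F t.1 t.2).prod

lemma Th_nil : Th F ([] : List (ℕ × V)) = 1 := by simp [Th]
lemma Th_cons (t : ℕ × V) (L : List (ℕ × V)) : Th F (t :: L) = th F t.1 t.2 * Th F L := by simp [Th]
lemma Th_append (L M : List (ℕ × V)) : Th F (L ++ M) = Th F L * Th F M := by simp [Th]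

/-- killed by all products of degree at least `s` -/
noncomputable def DD (P : V → F) (s : ℕ) : Submodule F (AddMonoidAlgebra F V) where
  carrier := {x | ∀ L : List (ℕ × V), (∀ t ∈ L, t.1 ≤ Fintype.card F - 1) →
    s ≤ (L.map Prod.fst).sum → x * Th F L ∈ KK P}
  zero_mem' := by intro L _ _; rw [zero_mul]; exact zero_mem _
  add_mem' := by
    intro x y hx hy L h1 h2
    rw [add_mul]; exact add_mem (hx L h1 h2) (hy L h1 h2)
  smul_mem' := by
    intro c x hx L h1 h2
    rw [smul_mul_assoc]; exact (KK P).smul_mem _ (hx L h1 h2)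

lemma DD_zero {P : V → F} {x : AddMonoidAlgebra F V} (hx : x ∈ DD P 0) : x ∈ KK P := by
  have := hx [] (by simp) (by simp)
  rwa [Th_nil, mul_one] at this

lemma KK_DD {P : V → F} {x : AddMonoidAlgebra F V} (hx : x ∈ KK P) (s : ℕ) : x ∈ DD P s :=
  fun _ _ _ => KK_mul hx _

lemma DD_mono {P : V → F} {x : AddMonoidAlgebra F V} {s t : ℕ} (h : s ≤ t) (hx : x ∈ DD P s) :
    x ∈ DD P t := fun L h1 h2 => hx L h1 (h.trans h2)

lemma DD_th {P : V → F} {x : AddMonoidAlgebra F V} {s j : ℕ} (hj : j ≤ Fintype.card F - 1) (v : V)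
    (hx : x ∈ DD P s) : x * th F j v ∈ DD P (s - j) := by
  intro L h1 h2
  rw [mul_assoc, ← Th_cons (j, v)]
  refine hx _ ?_ ?_
  · intro t ht
    rcases List.mem_cons.1 ht with rfl | ht
    · exact hj
    · exact h1 t ht
  · simp only [List.map_cons, List.sum_cons]; omega

lemma DD_span {P : V → F} {x : AddMonoidAlgebra F V} {s : ℕ} (hs : 1 ≤ s) (B : Set V)
    (hB : Submodule.span F B = ⊤)
    (h : ∀ b ∈ B, ∀ j, 1 ≤ j → j ≤ Fintype.card F - 1 → x * th F j b ∈ DD P (s - j)) :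
    x ∈ DD P s := by
  have key : ∀ v : V, ∀ j, 1 ≤ j → j ≤ Fintype.card F - 1 → x * th F j v ∈ DD P (s - j) := by
    intro v
    have hv : v ∈ Submodule.span F B := hB ▸ Submodule.mem_top
    induction hv using Submodule.span_induction with
    | mem b hb => exact h b hb
    | zero =>
      intro j h1 h2
      rw [th_zero_vec h1 h2, mul_zero]; exact zero_mem _
    | add v w _ _ hv hw =>
      intro j h1 h2
      rw [mul_comm]
      refine th_add_mem _ _ h2 v w ?_
      intro i i' hi hi' hii
      rcases Nat.eq_zero_or_pos i with rfl | hi0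
      · rw [th_zero, one_mul, mul_comm]
        exact DD_mono (by omega) (hw i' (by omega) hi')
      · have := DD_th hi' w (hv i hi0 hi)
        have e : th F i v * th F i' w * x = x * th F i v * th F i' w := by ring
        rw [e]
        exact DD_mono (by omega) this
    | smul a v _ hv =>
      intro j h1 h2
      rw [th_smul h2, mul_smul_comm]
      exact Submodule.smul_mem _ _ (hv j h1 h2)
  intro L
  induction L with
  | nil => intro _ h2; simp at h2; omega
  | cons t L ih =>
    intro h1 h2
    simp only [List.map_cons, List.sum_cons] at h2
    rw [Th_cons]
    rcases Nat.eq_zero_or_pos t.1 with h0 | h0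
    · rw [h0, th_zero, one_mul]
      exact ih (fun t ht => h1 t (List.mem_cons_of_mem _ ht)) (by omega)
    · rw [← mul_assoc]
      exact key t.2 t.1 h0 (h1 t List.mem_cons_self) L
        (fun t ht => h1 t (List.mem_cons_of_mem _ ht)) (by omega)

/-- scaling automorphism -/
noncomputable def scal (V : Type*) [AddCommGroup V] [Module F V] (a : F) :
    AddMonoidAlgebra F V →ₐ[F] AddMonoidAlgebra F V :=
  AddMonoidAlgebra.mapDomainAlgHom F F (DistribSMul.toAddMonoidHom V a)

lemma scal_X (a : F) (u : V) : scal V a (X F u) = X F (a • u) := by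
  simp [scal, X]

lemma scal_th {j : ℕ} (hj : j ≤ Fintype.card F - 1) (a : F) (v : V) :
    scal V a (th F j v) = a ^ j • th F j v := by
  rw [← th_smul hj]
  unfold th
  split_ifs
  · simp
  · simp only [raw, map_neg, map_sum, map_smul, scal_X, smul_smul, mul_comm]

lemma scal_Th (L : List (ℕ × V)) (hL : ∀ t ∈ L, t.1 ≤ Fintype.card F - 1) (a : F) :
    scal V a (Th F L) = a ^ (L.map Prod.fst).sum • Th F L := by
  induction L with
  | nil => simp [Th_nil]
  | cons t L ih =>
    rw [Th_cons, map_mul, ih (fun t ht => hL t (List.mem_cons_of_mem _ ht)),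
      scal_th (hL t List.mem_cons_self), smul_mul_smul_comm]
    simp [pow_add]

lemma ev_scal {P : V → F} (hP : ∀ a : F, a ≠ 0 → ∀ u, P (a • u) = P u) {a : F} (ha : a ≠ 0)
    (x : AddMonoidAlgebra F V) : ev P (scal V a x) = ev P x := by
  induction x using AddMonoidAlgebra.induction_linear with
  | zero => simp
  | add y z hy hz => rw [map_add, map_add, map_add, hy, hz]
  | single v c => rw [single_eq, map_smul, map_smul, map_smul, scal_X, ev_X, ev_X, hP a ha]

lemma ev_hom {P : V → F} (hP : ∀ a : F, a ≠ 0 → ∀ u, P (a • u) = P u)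
    (L : List (ℕ × V)) (hL : ∀ t ∈ L, t.1 ≤ Fintype.card F - 1)
    (hs : ¬ (Fintype.card F - 1) ∣ (L.map Prod.fst).sum) : ev P (Th F L) = 0 := by
  rw [← FiniteField.forall_pow_eq_one_iff (K := F)] at hs
  push Not at hs
  obtain ⟨a, ha⟩ := hs
  have h := ev_scal hP a.ne_zero (Th F L)
  rw [scal_Th L hL, map_smul, smul_eq_mul] at h
  by_contra h0
  apply ha
  have : (a : F) ^ (L.map Prod.fst).sum = 1 := by
    apply mul_right_cancel₀ h0; rw [h, one_mul]
  ext; simpa using this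

/-- coefficientwise Frobenius -/
noncomputable def frb (V : Type*) [AddCommGroup V] [Module F V] (p : ℕ) [ExpChar F p] (h : ℕ) :
    AddMonoidAlgebra F V →+* AddMonoidAlgebra F V :=
  AddMonoidAlgebra.mapRingHom V (iterateFrobenius F p h)

lemma frb_single (p : ℕ) [ExpChar F p] (h : ℕ) (u : V) (c : F) :
    frb V p h (c • X F u) = c ^ p ^ h • X F u := by
  rw [← single_eq, ← single_eq, frb, AddMonoidAlgebra.mapRingHom_single, iterateFrobenius_def]

lemma frb_X (p : ℕ) [ExpChar F p] (h : ℕ) (u : V) :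
    frb V p h (X F u) = X F u := by
  have := frb_single p h u (1 : F)
  simpa using this

lemma ev_frb (p : ℕ) [ExpChar F p] (h : ℕ) {P : V → F} (hP : ∀ u, P u ^ p = P u)
    (x : AddMonoidAlgebra F V) : ev P (frb V p h x) = ev P x ^ p ^ h := by
  have hP' : ∀ u, P u ^ p ^ h = P u := by
    intro u
    clear x
    induction h with
    | zero => simp
    | succ h ih => rw [pow_succ, pow_mul, ih, hP]
  induction x using AddMonoidAlgebra.induction_linear with
  | zero => simp [(expChar_pos F p).ne']
  | add y z hy hz => rw [map_add, map_add, map_add, hy, hz, add_pow_expChar_pow]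
  | single v c => rw [single_eq, frb_single, map_smul, map_smul, ev_X, smul_eq_mul, smul_eq_mul, mul_pow, hP']

lemma frb_KK (p : ℕ) [ExpChar F p] (h : ℕ) {P : V → F} (hP : ∀ u, P u ^ p = P u)
    {x : AddMonoidAlgebra F V} (hx : frb V p h x ∈ KK P) : x ∈ KK P := by
  intro u
  have := hx u
  rw [← frb_X p h, ← map_mul, ev_frb p h hP] at this
  exact pow_eq_zero_iff (pow_ne_zero _ (expChar_pos F p).ne') |>.1 this

lemma frb_th (p : ℕ) [ExpChar F p] (h : ℕ) {j j' : ℕ} (hj : 1 ≤ j) (hj' : 1 ≤ j')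
    (h1 : j ≤ Fintype.card F - 1) (h1' : j' ≤ Fintype.card F - 1)
    (hh : j = Fintype.card F - 1 ↔ j' = Fintype.card F - 1) {z : ℕ}
    (hz : p ^ h * j = j' + z * (Fintype.card F - 1)) (v : V) :
    frb V p h (th F j v) = th F j' v := by
  rw [th_pos hj, th_pos hj', raw, raw, map_neg, map_sum]
  congr 1
  refine sum_congr rfl fun a _ => ?_
  rw [frb_single]
  congr 1
  rw [← pow_mul]
  have h2 := two_le_card (F := F)
  have hp : 1 ≤ p ^ h := Nat.one_le_pow _ _ (expChar_pos F p)
  generalize hQ : Fintype.card F - 1 = Q at *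
  by_cases hjq : j = Q
  · rw [hjq, hh.1 hjq]; simp
  · have hjq' : j' ≠ Q := fun e => hjq (hh.2 e)
    by_cases ha : a = 0
    · subst ha
      rw [zero_pow, zero_pow]
      · omega
      · exact mul_ne_zero (by omega) (by omega)
    · have hau : a ^ Q = 1 := by rw [← hQ]; exact FiniteField.pow_card_sub_one_eq_one a ha
      have e1 : a ^ ((Q - j) * p ^ h) * a ^ (p ^ h * j) = 1 := by
        rw [← pow_add]
        have : (Q - j) * p ^ h + p ^ h * j = Q * p ^ h := by
          rw [mul_comm (p ^ h) j, ← add_mul]; congr 1; omega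
        rw [this, pow_mul, hau, one_pow]
      have e2 : a ^ (Q - j') * a ^ (p ^ h * j) = 1 := by
        rw [hz, ← pow_add]
        have : (Q - j') + (j' + z * Q) = Q * (z + 1) := by
          rw [mul_add, mul_comm Q z]; omega
        rw [this, pow_mul, hau, one_pow]
      exact mul_right_cancel₀ (pow_ne_zero _ ha) (e1.trans e2.symm)

end Ev
end G18

namespace G18
open Finset
set_option linter.unusedSectionVars false
set_option linter.unusedSimpArgs false

lemma lucas_pow {p : ℕ} [Fact p.Prime] (a : ℕ) : ∀ n k : ℕ,
    n.choose (p ^ a * k) ≡ (n / p ^ a).choose k [MOD p] := by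
  induction a with
  | zero => intro n k; simp; rfl
  | succ a ih =>
    intro n k
    have hp := (Fact.out : p.Prime).pos
    have h := Choose.choose_modEq_choose_mod_mul_choose_div_nat (n := n) (k := p ^ (a + 1) * k) (p := p)
    have e : p ^ (a + 1) * k = p * (p ^ a * k) := by ring
    rw [e, Nat.mul_mod_right, Nat.mul_div_cancel_left _ hp, Nat.choose_zero_right, one_mul] at h
    rw [e]
    refine h.trans ((ih (n / p) k).trans ?_)
    rw [Nat.div_div_eq_div_mul, pow_succ, mul_comm p]

lemma not_dvd_choose {p : ℕ} (hp : p.Prime) {n k : ℕ} (hk : k ≤ n) (hn : n < p) : ¬ p ∣ n.choose k := by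
  intro h
  have : p ∣ n.factorial := by
    rw [← Nat.choose_mul_factorial_mul_factorial hk, mul_assoc]
    exact h.mul_right _
  rw [hp.dvd_factorial] at this
  omega

section
variable {F : Type*} [Field F] {p : ℕ} [Fact p.Prime] [CharP F p]

lemma choose_small {n k : ℕ} (hk : k ≤ n) (hn : n < p) : ((n.choose k : ℕ) : F) ≠ 0 := by
  rw [Ne, CharP.cast_eq_zero_iff F p]
  exact not_dvd_choose Fact.out hk hn

lemma choose_pow_small {a n k : ℕ} (hk : k ≤ n / p ^ a) (hn : n / p ^ a < p) :
    ((n.choose (p ^ a * k) : ℕ) : F) ≠ 0 := by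
  rw [Ne, CharP.cast_eq_zero_iff F p, (lucas_pow a n k).dvd_iff dvd_rfl]
  exact not_dvd_choose Fact.out hk hn

lemma choose_val {a k : ℕ} (hk : ¬ p ∣ k) : (((p ^ a * k).choose (p ^ a) : ℕ) : F) ≠ 0 := by
  have h := lucas_pow (p := p) a (p ^ a * k) 1
  rw [mul_one, Nat.mul_div_cancel_left _ (pow_pos (Fact.out : p.Prime).pos a), Nat.choose_one_right] at h
  rw [Ne, CharP.cast_eq_zero_iff F p, h.dvd_iff dvd_rfl]
  exact hk

lemma choose_top {i : ℕ} (hi : i % p = p - 1) : ((i.choose (p - 1) : ℕ) : F) = 1 := by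
  have hp := (Fact.out : p.Prime).two_le
  have h := Choose.choose_modEq_choose_mod_mul_choose_div_nat (n := i) (k := p - 1) (p := p)
  rw [hi, Nat.mod_eq_of_lt (by omega : p - 1 < p), Nat.div_eq_of_lt (by omega : p - 1 < p), Nat.choose_self,
    Nat.choose_zero_right, one_mul] at h
  have := (CharP.natCast_eq_natCast F p).2 h
  simpa using this
end

lemma rot {p f a j : ℕ} (hp : 2 ≤ p) (ha : a < f) (hj : j < p ^ f) (hd : j / p ^ a % p = p - 1) :
    ∃ j', j' < p ^ f ∧ j' % p = p - 1 ∧ (j = p ^ f - 1 ↔ j' = p ^ f - 1) ∧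
      ∃ z, p ^ (f - a) * j = j' + z * (p ^ f - 1) := by
  obtain ⟨b, rfl⟩ : ∃ b, f = a + b + 1 := ⟨f - a - 1, by omega⟩
  have hSpos : 0 < p ^ a := pow_pos (by omega) _
  have eq1 : p ^ (a + b + 1) = p ^ a * p ^ b * p := by ring
  have eq2 : p ^ (a + b + 1 - a) = p ^ b * p := by
    rw [← pow_succ]; congr 1; omega
  rw [eq1] at hj ⊢
  rw [eq2]
  clear eq1 eq2
  generalize p ^ a = S at *
  generalize p ^ b = R at *
  have h1 := Nat.div_add_mod j S
  have h2 := Nat.div_add_mod (j / S) p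
  have h3 := Nat.mod_lt j hSpos
  rw [hd] at h2
  have hB : j / S / p < R := by
    rw [Nat.div_div_eq_div_mul, Nat.div_lt_iff_lt_mul (by positivity)]
    calc j < S * R * p := hj
      _ = R * (S * p) := by ring
  generalize j % S = A at *
  generalize j / S / p = B at *
  obtain ⟨x, rfl⟩ : ∃ x, S = A + 1 + x := ⟨S - A - 1, by omega⟩
  obtain ⟨y, rfl⟩ : ∃ y, R = B + 1 + y := ⟨R - B - 1, by omega⟩
  obtain ⟨c, rfl⟩ : ∃ c, p = c + 1 := ⟨p - 1, by omega⟩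
  have hc : c + 1 - 1 = c := by omega
  rw [hc] at hd h2 ⊢
  rw [← h2] at h1
  have k1 : j + x + (A + 1 + x) * (c + 1) * y + 1 = (A + 1 + x) * (B + 1 + y) * (c + 1) := by
    rw [← h1]; ring
  have k2 : (A * ((B + 1 + y) * (c + 1)) + B * (c + 1) + c) + x * ((B + 1 + y) * (c + 1)) + (c + 1) * y + 1
      = (A + 1 + x) * (B + 1 + y) * (c + 1) := by ring
  refine ⟨A * ((B + 1 + y) * (c + 1)) + B * (c + 1) + c, ?_, ?_, ?_, B * (c + 1) + c, ?_⟩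
  · omega
  · have : A * ((B + 1 + y) * (c + 1)) + B * (c + 1) + c = c + (c + 1) * (A * (B + 1 + y) + B) := by ring
    rw [this, Nat.add_mul_mod_self_left, Nat.mod_eq_of_lt (by omega)]
  · rw [← k2]
    have e1 : j = A * ((B + 1 + y) * (c + 1)) + B * (c + 1) + c + x * ((B + 1 + y) * (c + 1)) + (c + 1) * y + 1 - 1
      ↔ x = 0 ∧ y = 0 := by
      rw [k2]
      constructor
      · intro h
        have : x = 0 ∧ (A + 1 + x) * (c + 1) * y = 0 := by omega
        refine ⟨this.1, ?_⟩
        have := this.2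
        simpa using this
      · rintro ⟨rfl, rfl⟩
        simp only [mul_zero, add_zero] at k1 ⊢
        omega
    rw [e1]
    constructor
    · rintro ⟨rfl, rfl⟩; simp
    · intro h
      have : x * ((B + 1 + y) * (c + 1)) = 0 ∧ (c + 1) * y = 0 := by omega
      simpa using this
  · have : (A + 1 + x) * (B + 1 + y) * (c + 1) - 1 = j + x + (A + 1 + x) * (c + 1) * y := by omega
    rw [this, ← h1]
    ring

lemma nonstuck {p f a j : ℕ} (hp : 2 ≤ p) (ha : a < f) (hj : j < p ^ f) (hd : j / p ^ a % p ≠ p - 1) :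
    j + p ^ a < p ^ f := by
  obtain ⟨b, rfl⟩ : ∃ b, f = a + b + 1 := ⟨f - a - 1, by omega⟩
  have hSpos : 0 < p ^ a := pow_pos (by omega) _
  have eq1 : p ^ (a + b + 1) = p ^ a * p ^ b * p := by ring
  rw [eq1] at hj ⊢
  generalize p ^ a = S at *
  generalize p ^ b = R at *
  have h1 := Nat.div_add_mod j S
  have h2 := Nat.div_add_mod (j / S) p
  have h3 := Nat.mod_lt j hSpos
  have h4 := Nat.mod_lt (j / S) (by omega : 0 < p)
  have hB : j / S / p < R := by
    rw [Nat.div_div_eq_div_mul, Nat.div_lt_iff_lt_mul (by positivity)]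
    calc j < S * R * p := hj
      _ = R * (S * p) := by ring
  have h5 : j / S % p + 2 ≤ p := by omega
  rw [← h2] at h1
  generalize j % S = A at *
  generalize j / S / p = B at *
  generalize j / S % p = D at *
  have h6 : S * (D + 2) ≤ S * p := Nat.mul_le_mul_left _ h5
  have h7 : S * p * (B + 1) ≤ S * p * R := Nat.mul_le_mul_left _ hB
  nlinarith

end G18

namespace G18
open Finset
set_option linter.unusedSectionVars false
set_option linter.unusedSimpArgs false

/-- hypotheses of the core lemma -/
structure CoreHyp {F : Type*} [Field F] [Fintype F] {V : Type*} [AddCommGroup V] [Module F V]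
    (p r : ℕ) (P : V → F) (Good : Submodule F V → Prop) : Prop where
  frob : ∀ u, P u ^ p = P u
  hom : ∀ a : F, a ≠ 0 → ∀ u, P (a • u) = P u
  mono : ∀ E E' : Submodule F V, E' ≤ E → Good E → Good E'
  bot : Good ⊥
  g1 : ∀ E, Good E → ∀ u ∈ E, P u = 0
  g2 : ∀ E, Good E → ∀ c ∈ E, ∀ u, ∑ a : F, P (u + a • c) = 0
  g3 : ∀ E : Submodule F V, Good E → Module.finrank F E ≤ r →
    Submodule.span F {b | Good (E ⊔ Submodule.span F {b})} = ⊤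

/-- span of a list -/
def lsp (F : Type*) [Field F] {V : Type*} [AddCommGroup V] [Module F V] (cs : List V) : Submodule F V :=
  Submodule.span F {v | v ∈ cs}

section Core
variable {F : Type*} [Field F] [Fintype F] {V : Type*} [AddCommGroup V] [Module F V]
variable {p f r : ℕ} {P : V → F} {Good : Submodule F V → Prop}

lemma mem_lsp {cs : List V} {v : V} (h : v ∈ cs) : v ∈ lsp F cs := Submodule.subset_span h

lemma lsp_le {cs : List V} {E : Submodule F V} (h : ∀ v ∈ cs, v ∈ E) : lsp F cs ≤ E :=
  Submodule.span_le.2 h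

lemma finrank_lsp (cs : List V) : Module.finrank F (lsp F cs) ≤ cs.length := by
  classical
  have h := finrank_span_finset_le_card (R := F) (M := V) cs.toFinset
  have e : ((cs.toFinset : Finset V) : Set V) = {v | v ∈ cs} := by ext; simp
  rw [Set.finrank, e] at h
  exact h.trans (List.toFinset_card_le cs)

lemma th_top_mem (H : CoreHyp p r P Good) {E : Submodule F V} (hE : Good E) {c : V} (hc : c ∈ E) :
    th F (Fintype.card F - 1) c ∈ KK P := by
  have h2 := two_le_card (F := F)
  intro u
  rw [th_pos (by omega), raw]
  simp only [Nat.sub_self, pow_zero, one_smul, neg_mul, sum_mul, map_neg, map_sum, ← X_add, ev_X]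
  rw [neg_eq_zero, ← H.g2 E hE c hc u]
  exact sum_congr rfl fun a _ => by rw [add_comm]

lemma base_lemma (H : CoreHyp p r P Good) {E : Submodule F V} (hE : Good E) :
    ∀ n : ℕ, ∀ L : List (ℕ × V), L.length = n → (∀ t ∈ L, t.2 ∈ E) →
      (L.map Prod.fst).sum = Fintype.card F - 1 → Th F L ∈ KK P := by
  have h2 := two_le_card (F := F)
  intro n
  induction n with
  | zero =>
    intro L hL _ hs
    rw [List.length_eq_zero_iff] at hL
    subst hL
    simp at hs; omega
  | succ n ih =>
    intro L hL hm hs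
    match L, hL, hm, hs with
    | [t], _, hm, hs =>
      rw [Th_cons, Th_nil, mul_one]
      simp at hs
      rw [hs]
      exact th_top_mem H hE (hm t (by simp))
    | t :: t' :: L, hL, hm, hs =>
      simp only [List.map_cons, List.sum_cons] at hs
      rw [Th_cons, Th_cons]
      rcases Nat.eq_zero_or_pos t'.1 with h0 | h0
      · rw [h0, th_zero, one_mul, ← Th_cons]
        apply ih
        · simpa using hL
        · intro s hs'
          apply hm
          simp only [List.mem_cons] at hs' ⊢
          tauto
        · simp only [List.map_cons, List.sum_cons]; omega
      · rw [← mul_assoc]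
        refine split_mem _ _ h0 (by omega) _ _ ?_ ?_
        · intro a
          have := ih ((t.1 + t'.1, t.2 + a • t'.2) :: L) (by simpa using hL) ?_ ?_
          · rwa [Th_cons] at this
          · intro s hs'
            simp only [List.mem_cons] at hs'
            rcases hs' with rfl | hs'
            · exact E.add_mem (hm t (by simp)) (E.smul_mem _ (hm t' (by simp)))
            · exact hm s (by simp [hs'])
          · simp only [List.map_cons, List.sum_cons]; omega
        · exact KK_mul (KK_mul (th_top_mem H hE (hm t (by simp))) _) _

lemma fill [Fact p.Prime] [CharP F p] (hpq : p ≤ Fintype.card F) (cs : List V) :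
    ∀ T : ℕ, T ≤ cs.length * (p - 1) →
    ∃ (L : List (ℕ × V)) (y : AddMonoidAlgebra F V), (∀ t ∈ L, t.2 ∈ cs) ∧
      (L.map Prod.fst).sum = T ∧ (cs.map (th F (p - 1))).prod = Th F L * y := by
  have hp := (Fact.out : p.Prime).two_le
  induction cs with
  | nil =>
    intro T hT
    refine ⟨[], 1, by simp, ?_, by simp [Th_nil]⟩
    simp at hT ⊢; omega
  | cons c cs ih =>
    intro T hT
    rw [List.length_cons, add_mul, one_mul] at hT
    obtain ⟨L, y, h1, h3, h4⟩ := ih (T - min T (p - 1)) (by omega)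
    have hu : min T (p - 1) ≤ p - 1 := min_le_right _ _
    have hu' : min T (p - 1) ≤ T := min_le_left _ _
    generalize min T (p - 1) = u at *
    have hm := th_mul (F := F) (i := u) (j := p - 1 - u) (by omega) c
    rw [Nat.add_sub_cancel' hu] at hm
    have hne := choose_small (F := F) (p := p) hu (by omega)
    refine ⟨(u, c) :: L, (((p - 1).choose u : ℕ) : F)⁻¹ • (th F (p - 1 - u) c * y), ?_, ?_, ?_⟩
    · intro t ht
      rcases List.mem_cons.1 ht with rfl | ht
      · simp
      · exact List.mem_cons_of_mem _ (h1 t ht)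
    · simp only [List.map_cons, List.sum_cons, h3]; omega
    · rw [List.map_cons, List.prod_cons, h4, Th_cons, mul_smul_comm]
      have : th F u c * Th F L * (th F (p - 1 - u) c * y)
        = (th F u c * th F (p - 1 - u) c) * (Th F L * y) := by ring
      simp only [this, hm, smul_mul_assoc, smul_smul]
      rw [inv_mul_cancel₀ hne, one_smul]

lemma phase2 [Fact p.Prime] [CharP F p] (hf : 1 ≤ f) (hq : Fintype.card F = p ^ f)
    (H : CoreHyp p r P Good) (cs : List V)
    (hr : cs.length + 1 ≤ r) (hm : p ^ (f - 1) - 1 ≤ cs.length * (p - 1)) :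
    ∀ s : ℕ, ∀ (c₁ : V) (i₁ : ℕ), Good (lsp F (c₁ :: cs)) → i₁ ≤ Fintype.card F - 1 →
      Fintype.card F - 1 ≤ i₁ + cs.length * (p - 1) + s →
      th F i₁ c₁ * (cs.map (th F (p - 1))).prod ∈ DD P s := by
  have hp := (Fact.out : p.Prime).two_le
  have hpq : p ≤ Fintype.card F := by
    rw [hq]; exact Nat.le_self_pow (by omega) p
  intro s
  induction s using Nat.strong_induction_on with
  | _ s ih =>
  intro c₁ i₁ hg hi hs
  rcases Nat.eq_zero_or_pos s with rfl | hs0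
  · apply KK_DD
    obtain ⟨L, y, h1, h3, h4⟩ := fill hpq cs (Fintype.card F - 1 - i₁) (by omega)
    rw [h4, ← mul_assoc, ← Th_cons (i₁, c₁)]
    apply KK_mul
    refine base_lemma H hg _ _ rfl ?_ ?_
    · intro t ht
      rcases List.mem_cons.1 ht with rfl | ht
      · exact mem_lsp (by simp)
      · exact mem_lsp (List.mem_cons_of_mem _ (h1 t ht))
    · simp only [List.map_cons, List.sum_cons, h3]; omega
  · refine DD_span hs0 _ (H.g3 _ hg ((finrank_lsp _).trans (by simpa using hr))) ?_
    intro b hb j hj1 hj2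
    have hb : Good (lsp F (c₁ :: cs) ⊔ Submodule.span F {b}) := hb
    have hbm : b ∈ lsp F (c₁ :: cs) ⊔ Submodule.span F {b} :=
      Submodule.mem_sup_right (Submodule.mem_span_singleton_self b)
    have hcm : ∀ v ∈ c₁ :: cs, v ∈ lsp F (c₁ :: cs) ⊔ Submodule.span F {b} :=
      fun v hv => Submodule.mem_sup_left (mem_lsp hv)
    have e : th F i₁ c₁ * (cs.map (th F (p - 1))).prod * th F j b
        = th F i₁ c₁ * th F j b * (cs.map (th F (p - 1))).prod := by ring
    rw [e]
    by_cases hc : i₁ + j ≤ Fintype.card F - 1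
    · refine split_mem _ _ hj1 hc _ _ ?_ ?_
      · intro a
        refine ih (s - j) (by omega) _ _ ?_ hc (by omega)
        refine H.mono _ _ (lsp_le ?_) hb
        intro v hv
        rcases List.mem_cons.1 hv with rfl | hv
        · exact add_mem (hcm c₁ (by simp)) (Submodule.smul_mem _ _ hbm)
        · exact hcm v (List.mem_cons_of_mem _ hv)
      · exact KK_DD (KK_mul (KK_mul (th_top_mem H hg (mem_lsp (by simp))) _) _) _
    · apply KK_DD
      obtain ⟨g, rfl⟩ : ∃ g, f = g + 1 := ⟨f - 1, by omega⟩
      have hQ : 0 < p ^ g := pow_pos (by omega) _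
      set T := Fintype.card F - 1 - j with hT
      have hTi : T < i₁ := by omega
      have hmod := Nat.mod_lt T hQ
      have hdm := Nat.div_add_mod T (p ^ g)
      rw [Nat.add_sub_cancel] at hm
      obtain ⟨L, y, h1, h3, h4⟩ := fill hpq cs (T % p ^ g) (by omega)
      have ht : T / p ^ g ≤ i₁ / p ^ g := Nat.div_le_div_right hTi.le
      have hlt : i₁ / p ^ g < p := by
        rw [Nat.div_lt_iff_lt_mul hQ, ← pow_succ', ← hq]; omega
      have hne := choose_pow_small (F := F) (p := p) ht hlt
      have hle : p ^ g * (T / p ^ g) ≤ i₁ := by omega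
      have hmul := th_mul (F := F) (i := p ^ g * (T / p ^ g)) (j := i₁ - p ^ g * (T / p ^ g)) (by omega) c₁
      rw [Nat.add_sub_cancel' hle] at hmul
      have hth : th F i₁ c₁ = ((i₁.choose (p ^ g * (T / p ^ g)) : ℕ) : F)⁻¹ •
          (th F (p ^ g * (T / p ^ g)) c₁ * th F (i₁ - p ^ g * (T / p ^ g)) c₁) := by
        rw [hmul, smul_smul, inv_mul_cancel₀ hne, one_smul]
      rw [hth, h4, smul_mul_assoc, smul_mul_assoc]
      apply Submodule.smul_mem
      have e2 : th F (p ^ g * (T / p ^ g)) c₁ * th F (i₁ - p ^ g * (T / p ^ g)) c₁ * th F j b * (Th F L * y)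
        = Th F ((p ^ g * (T / p ^ g), c₁) :: (j, b) :: L) * (th F (i₁ - p ^ g * (T / p ^ g)) c₁ * y) := by
        rw [Th_cons, Th_cons]; ring
      rw [e2]
      apply KK_mul
      refine base_lemma H hb _ _ rfl ?_ ?_
      · intro t ht
        rcases List.mem_cons.1 ht with rfl | ht
        · exact hcm _ (by simp)
        rcases List.mem_cons.1 ht with rfl | ht
        · exact hbm
        · exact hcm _ (List.mem_cons_of_mem _ (h1 t ht))
      · simp only [List.map_cons, List.sum_cons, h3]; omega

lemma factor_top [Fact p.Prime] [CharP F p] (L : List (ℕ × V))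
    (h1 : ∀ t ∈ L, t.1 ≤ Fintype.card F - 1) (h2 : ∀ t ∈ L, t.1 % p = p - 1) :
    ∃ L' : List (ℕ × V), (∀ t ∈ L', t.1 ≤ Fintype.card F - 1) ∧
      (L'.map Prod.fst).sum + L.length * (p - 1) = (L.map Prod.fst).sum ∧
      Th F L = ((L.map Prod.snd).map (th F (p - 1))).prod * Th F L' := by
  induction L with
  | nil => exact ⟨[], by simp, by simp, by simp [Th_nil]⟩
  | cons t L ih =>
    obtain ⟨L', k1, k2, k3⟩ := ih (fun t ht => h1 t (List.mem_cons_of_mem _ ht))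
      (fun t ht => h2 t (List.mem_cons_of_mem _ ht))
    have ht1 := h1 t (by simp)
    have ht2 := h2 t (by simp)
    have hle : p - 1 ≤ t.1 := ht2 ▸ Nat.mod_le _ _
    refine ⟨(t.1 - (p - 1), t.2) :: L', ?_, ?_, ?_⟩
    · intro s hs
      rcases List.mem_cons.1 hs with rfl | hs
      · simp only; omega
      · exact k1 s hs
    · simp only [List.map_cons, List.sum_cons, List.length_cons, add_mul, one_mul]; omega
    · have hmul := th_mul (F := F) (i := p - 1) (j := t.1 - (p - 1)) (by omega) t.2
      rw [Nat.add_sub_cancel' hle, choose_top ht2, one_smul] at hmul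
      rw [Th_cons, Th_cons, k3, ← hmul]
      simp only [List.map_cons, List.prod_cons]
      ring

lemma stuck0 [Fact p.Prime] [CharP F p] (hf : 1 ≤ f) (hq : Fintype.card F = p ^ f)
    (H : CoreHyp p r P Good) (L : List (ℕ × V))
    (hr : L.length + 1 ≤ r) (hm : p ^ (f - 1) - 1 ≤ L.length * (p - 1))
    (h1 : ∀ t ∈ L, t.1 ≤ Fintype.card F - 1) (h2 : ∀ t ∈ L, t.1 % p = p - 1)
    (hg : Good (lsp F (L.map Prod.snd))) : Th F L ∈ KK P := by
  have hc2 := two_le_card (F := F)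
  have hp := (Fact.out : p.Prime).two_le
  intro u
  rw [X_eq, mul_sum, map_sum]
  refine sum_eq_zero fun j hj => ?_
  have hj := mem_range.1 hj
  by_cases hdiv : (Fintype.card F - 1) ∣ (((j, u) :: L).map Prod.fst).sum
  · simp only [List.map_cons, List.sum_cons] at hdiv
    rcases Nat.eq_zero_or_pos (j + (L.map Prod.fst).sum) with h0 | h0
    · have hj0 : j = 0 := by omega
      have hL : L = [] := by
        rcases L with _ | ⟨t, L⟩
        · rfl
        · simp at h0
          have := h2 t (by simp)
          rw [h0.2.1] at this
          simp at this; omega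
      subst hL; subst hj0
      rw [th_zero, Th_nil, mul_one, ← X_zero, ev_X]
      exact H.g1 _ H.bot 0 (Submodule.zero_mem _)
    · have hge := Nat.le_of_dvd h0 hdiv
      obtain ⟨L', k1, k2, k3⟩ := factor_top (F := F) (p := p) L h1 h2
      have hX := phase2 hf hq H (L.map Prod.snd) (by simpa using hr) (by simpa using hm)
        (Fintype.card F - 1 - L.length * (p - 1)) 0 0 ?_ (by omega) (by simp; omega)
      · rw [th_zero, one_mul] at hX
        rw [k3, mul_assoc, mul_comm (Th F L'), ← Th_cons (j, u)]
        apply KK_ev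
        apply hX
        · intro t ht
          rcases List.mem_cons.1 ht with rfl | ht
          · simp only; omega
          · exact k1 t ht
        · simp only [List.map_cons, List.sum_cons]; omega
      · refine H.mono _ _ (lsp_le ?_) hg
        intro v hv
        rcases List.mem_cons.1 hv with rfl | hv
        · exact Submodule.zero_mem _
        · exact mem_lsp hv
  · rw [mul_comm, ← Th_cons (j, u)]
    refine ev_hom H.hom _ ?_ hdiv
    intro t ht
    rcases List.mem_cons.1 ht with rfl | ht
    · simp only; omega
    · exact h1 t ht

lemma stuck [Fact p.Prime] [CharP F p] (hf : 1 ≤ f) (hq : Fintype.card F = p ^ f)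
    (H : CoreHyp p r P Good) (L : List (ℕ × V))
    (hr : L.length + 1 ≤ r) (hm : p ^ (f - 1) - 1 ≤ L.length * (p - 1))
    (h1 : ∀ t ∈ L, t.1 ≤ Fintype.card F - 1) {a : ℕ} (ha : a < f)
    (h2 : ∀ t ∈ L, t.1 / p ^ a % p = p - 1)
    (hg : Good (lsp F (L.map Prod.snd))) : Th F L ∈ KK P := by
  have hc2 := two_le_card (F := F)
  have hp := (Fact.out : p.Prime).two_le
  have : ExpChar F p := ExpChar.prime Fact.out
  have key : ∀ L : List (ℕ × V), (∀ t ∈ L, t.1 ≤ Fintype.card F - 1) →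
      (∀ t ∈ L, t.1 / p ^ a % p = p - 1) → ∃ L' : List (ℕ × V), L'.length = L.length ∧
        L'.map Prod.snd = L.map Prod.snd ∧ (∀ t ∈ L', t.1 ≤ Fintype.card F - 1) ∧
        (∀ t ∈ L', t.1 % p = p - 1) ∧ frb V p (f - a) (Th F L) = Th F L' := by
    intro L
    induction L with
    | nil => intro _ _; exact ⟨[], rfl, rfl, by simp, by simp, by simp [Th_nil]⟩
    | cons t L ih =>
      intro h1 h2
      obtain ⟨L', k1, k2, k3, k4, k5⟩ := ih (fun t ht => h1 t (List.mem_cons_of_mem _ ht))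
        (fun t ht => h2 t (List.mem_cons_of_mem _ ht))
      have ht1 := h1 t (by simp)
      have ht2 := h2 t (by simp)
      obtain ⟨j', m1, m2, m3, z, m4⟩ := rot hp ha (by omega : t.1 < p ^ f) ht2
      rw [← hq] at m1 m3 m4
      have hpos : 1 ≤ t.1 := by
        by_contra h
        have : t.1 = 0 := by omega
        rw [this] at ht2; simp at ht2; omega
      have hpos' : 1 ≤ j' := by
        by_contra h
        have : j' = 0 := by omega
        rw [this] at m2; simp at m2; omega
      refine ⟨(j', t.2) :: L', by simp [k1], by simp [k2], ?_, ?_, ?_⟩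
      · intro s hs
        rcases List.mem_cons.1 hs with rfl | hs
        · simp only; omega
        · exact k3 s hs
      · intro s hs
        rcases List.mem_cons.1 hs with rfl | hs
        · exact m2
        · exact k4 s hs
      · rw [Th_cons, map_mul, k5, Th_cons, frb_th p (f - a) hpos hpos' ht1 (by omega) m3 m4]
  obtain ⟨L', k1, k2, k3, k4, k5⟩ := key L h1 h2
  refine frb_KK p (f - a) H.frob ?_
  rw [k5]
  exact stuck0 hf hq H L' (by omega) (by rwa [k1]) k3 k4 (by rwa [k2])

lemma ev_supp (H : CoreHyp p r P Good) {E : Submodule F V} (hE : Good E) (L : List (ℕ × V)) :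
    (∀ t ∈ L, t.2 ∈ E) → ∀ w ∈ E, ev P (Th F L * X F w) = 0 := by
  induction L with
  | nil =>
    intro _ w hw
    rw [Th_nil, one_mul, ev_X]
    exact H.g1 E hE w hw
  | cons t L ih =>
    intro hL w hw
    have ih := ih (fun t ht => hL t (List.mem_cons_of_mem _ ht))
    rw [Th_cons]
    rcases Nat.eq_zero_or_pos t.1 with h0 | h0
    · rw [h0, th_zero, one_mul]; exact ih w hw
    · rw [th_pos h0, raw]
      simp only [neg_mul, sum_mul, map_neg, map_sum, smul_mul_assoc, map_smul]
      rw [neg_eq_zero]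
      refine sum_eq_zero fun a _ => ?_
      have : X F (a • t.2) * Th F L * X F w = Th F L * X F (a • t.2 + w) := by
        rw [X_add]; ring
      rw [this, ih _ (E.add_mem (E.smul_mem _ (hL t (by simp))) hw), smul_zero]

lemma phase1 [Fact p.Prime] [CharP F p] (hf : 1 ≤ f) (hq : Fintype.card F = p ^ f)
    (H : CoreHyp p r P Good) {m : ℕ}
    (hr : m + 1 ≤ r) (hm : p ^ (f - 1) - 1 ≤ m * (p - 1)) :
    ∀ N : ℕ, ∀ L : List (ℕ × V), L.length = m → (∀ t ∈ L, t.1 ≤ Fintype.card F - 1) →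
      (L.map fun t => Fintype.card F - 1 - t.1).sum = N →
      Good (lsp F (L.map Prod.snd)) → Th F L ∈ KK P := by
  have hc2 := two_le_card (F := F)
  have hp := (Fact.out : p.Prime).two_le
  intro N
  induction N using Nat.strong_induction_on with
  | _ N ih =>
  intro L hlen h1 hN hg
  by_cases hst : ∃ a < f, ∀ t ∈ L, t.1 / p ^ a % p = p - 1
  · obtain ⟨a, ha, h2⟩ := hst
    exact stuck hf hq H L (by omega) (by rwa [hlen]) h1 ha h2 hg
  push Not at hst
  have hspan := H.g3 _ hg ((finrank_lsp _).trans (by simp; omega))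
  set B := {b | Good (lsp F (L.map Prod.snd) ⊔ Submodule.span F {b})} with hB
  have s1 : ∀ b ∈ B, ∀ a < f, Th F L * th F (p ^ a) b ∈ KK P := by
    intro b hb a ha
    have hb : Good (lsp F (L.map Prod.snd) ⊔ Submodule.span F {b}) := hb
    obtain ⟨t, htL, htd⟩ := hst a ha
    have hns := nonstuck hp ha (by have := h1 t htL; omega) htd
    obtain ⟨L1, L2, rfl⟩ := List.append_of_mem htL
    have hpa : 1 ≤ p ^ a := Nat.one_le_pow _ _ (by omega)
    have e : Th F (L1 ++ t :: L2) * th F (p ^ a) b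
        = th F t.1 t.2 * th F (p ^ a) b * (Th F L1 * Th F L2) := by
      rw [Th_append, Th_cons]; ring
    rw [e]
    refine split_mem _ _ hpa (by omega) _ _ ?_ ?_
    · intro α
      have := ih ((L1 ++ (t.1 + p ^ a, t.2 + α • b) :: L2).map fun t => Fintype.card F - 1 - t.1).sum ?_
        (L1 ++ (t.1 + p ^ a, t.2 + α • b) :: L2) ?_ ?_ rfl ?_
      · rw [Th_append, Th_cons] at this
        convert this using 1
        ring
      · rw [← hN]
        simp only [List.map_append, List.map_cons, List.sum_append, List.sum_cons]
        omega
      · simpa using hlen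
      · intro s hs
        rcases List.mem_append.1 hs with hs | hs
        · exact h1 s (by simp [hs])
        rcases List.mem_cons.1 hs with rfl | hs
        · simp only; omega
        · exact h1 s (by simp [hs])
      · refine H.mono _ _ (lsp_le ?_) hb
        intro v hv
        obtain ⟨s, hs, rfl⟩ := List.mem_map.1 hv
        have hin : ∀ s ∈ L1 ++ t :: L2, s.2 ∈ lsp F ((L1 ++ t :: L2).map Prod.snd) ⊔ Submodule.span F {b} :=
          fun s hs => Submodule.mem_sup_left (mem_lsp (List.mem_map_of_mem hs))
        rcases List.mem_append.1 hs with hs | hs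
        · exact hin s (by simp [hs])
        rcases List.mem_cons.1 hs with rfl | hs
        · exact add_mem (hin t (by simp)) (Submodule.smul_mem _ _
            (Submodule.mem_sup_right (Submodule.mem_span_singleton_self b)))
        · exact hin s (by simp [hs])
    · exact KK_mul (KK_mul (th_top_mem H hg (mem_lsp (List.mem_map_of_mem htL))) _) _
  have s2 : ∀ b ∈ B, ∀ j, 1 ≤ j → j ≤ Fintype.card F - 1 → Th F L * th F j b ∈ KK P := by
    intro b hb j hj1 hj2
    obtain ⟨a, k, hk, rfl⟩ := Nat.exists_eq_pow_mul_and_not_dvd (n := j) (by omega) p (by omega)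
    have hk1 : 1 ≤ k := by
      by_contra h
      have : k = 0 := by omega
      simp [this] at hj1
    have hle : p ^ a ≤ p ^ a * k := Nat.le_mul_of_pos_right _ hk1
    have ha : a < f := by
      rw [← Nat.pow_lt_pow_iff_right (a := p) (by omega)]; omega
    have hne := choose_val (F := F) (p := p) (a := a) hk
    have hmul := th_mul (F := F) (i := p ^ a) (j := p ^ a * k - p ^ a) (by omega) b
    rw [Nat.add_sub_cancel' hle] at hmul
    have hth : th F (p ^ a * k) b = (((p ^ a * k).choose (p ^ a) : ℕ) : F)⁻¹ •
        (th F (p ^ a) b * th F (p ^ a * k - p ^ a) b) := by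
      rw [hmul, smul_smul, inv_mul_cancel₀ hne, one_smul]
    rw [hth, mul_smul_comm, ← mul_assoc]
    exact Submodule.smul_mem _ _ (KK_mul (s1 b hb a ha) _)
  have s3 : ∀ u : V, ∀ t : F, Th F L * X F (t • u) - Th F L ∈ KK P := by
    intro u
    have hu : u ∈ Submodule.span F B := hspan ▸ Submodule.mem_top
    induction hu using Submodule.span_induction with
    | mem b hb =>
      intro t
      obtain ⟨n, hn⟩ : ∃ n, Fintype.card F = n + 1 := ⟨Fintype.card F - 1, by omega⟩
      rw [X_smul, hn, sum_range_succ', th_zero, pow_zero, one_smul, mul_add, mul_one, add_sub_cancel_right,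
        mul_sum]
      refine Submodule.sum_mem _ fun j hj => ?_
      rw [mul_smul_comm]
      have := mem_range.1 hj
      exact Submodule.smul_mem _ _ (s2 b hb _ (by omega) (by omega))
    | zero =>
      intro t; rw [smul_zero, X_zero, mul_one, sub_self]; exact zero_mem _
    | add v w _ _ hv hw =>
      intro t
      have : Th F L * X F (t • (v + w)) - Th F L
          = (Th F L * X F (t • v) - Th F L) * X F (t • w) + (Th F L * X F (t • w) - Th F L) := by
        rw [smul_add, X_add]; ring
      rw [this]
      exact add_mem (KK_mul (hv t) _) (hw t)
    | smul a v _ hv =>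
      intro t; rw [smul_smul]; exact hv _
  intro u
  have h3 := KK_ev (s3 u 1)
  have h4 := ev_supp H hg L (fun t ht => mem_lsp (List.mem_map_of_mem ht)) 0 (zero_mem _)
  rw [X_zero, mul_one] at h4
  rw [map_sub, h4, sub_zero, one_smul] at h3
  exact h3

theorem core [Fact p.Prime] [CharP F p] (hf : 1 ≤ f) (hq : Fintype.card F = p ^ f)
    (H : CoreHyp p r P Good) {m : ℕ}
    (hr : m + 1 ≤ r) (hm : p ^ (f - 1) - 1 ≤ m * (p - 1)) (u : V) : P u = 0 := by
  have := phase1 hf hq H hr hm _ (List.replicate m ((0 : ℕ), (0 : V))) (by simp) ?_ rfl ?_ u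
  · have e : Th F (List.replicate m ((0 : ℕ), (0 : V))) = 1 := by
      simp [Th, th_zero]
    rwa [e, one_mul, ev_X] at this
  · intro t ht
    rw [(List.mem_replicate.1 ht).2]; simp
  · refine H.mono _ _ (lsp_le ?_) H.bot
    intro v hv
    simp at hv
    simp [hv.2]
end Core
end G18

namespace G18
open Finset Module
set_option linter.unusedSectionVars false
set_option linter.unusedSimpArgs false

lemma gbound_zero (q d : ℕ) : gbound q 0 d = 0 := by simp [gbound]

lemma gbound_succ {q : ℕ} (hq : 1 ≤ q) (k d : ℕ) :
    gbound q (k + 1) d = d + gbound q k ((d + q - 1) / q) := by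
  unfold gbound
  rw [sum_range_succ', add_comm]
  congr 1
  · simp
  · refine sum_congr rfl fun i _ => ?_
    have h1 : 1 ≤ q ^ i := Nat.one_le_pow _ _ hq
    rw [pow_succ', ← Nat.div_div_eq_div_mul]
    congr 1
    obtain ⟨m, hm⟩ : ∃ m, q ^ i = m + 1 := ⟨q ^ i - 1, by omega⟩
    rw [hm]
    have : d + q * (m + 1) - 1 = (d + q - 1) + q * m := by rw [mul_add]; omega
    rw [this, Nat.add_mul_div_left _ _ (by omega)]
    generalize (d + q - 1) / q = z
    omega

lemma gbound_mono {q k d d' : ℕ} (h : d ≤ d') : gbound q k d ≤ gbound q k d' := by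
  unfold gbound
  refine sum_le_sum fun i _ => Nat.div_le_div_right (by omega)

lemma gbound_lt {q k d : ℕ} (hq : 1 ≤ q) : gbound q (k + 1) d < gbound q (k + 1) (d + 1) := by
  rw [gbound_succ hq, gbound_succ hq]
  have : gbound q k ((d + q - 1) / q) ≤ gbound q k ((d + 1 + q - 1) / q) :=
    gbound_mono (Nat.div_le_div_right (by omega))
  omega

section Codes
variable {F : Type*} [Field F] [Fintype F] {V : Type*} [AddCommGroup V] [Module F V]
variable {ι : Type*} [Fintype ι]

open Classical in
/-- weight -/
noncomputable def w (φ : ι → V →ₗ[F] F) (v : V) : ℕ := (univ.filter fun i => φ i v ≠ 0).card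

open Classical in
/-- weight outside the support of `c` -/
noncomputable def w0 (φ : ι → V →ₗ[F] F) (c v : V) : ℕ :=
  (univ.filter fun i => φ i c = 0 ∧ φ i v ≠ 0).card

lemma w_zero (φ : ι → V →ₗ[F] F) : w φ 0 = 0 := by simp [w]

lemma w_smul (φ : ι → V →ₗ[F] F) {a : F} (ha : a ≠ 0) (v : V) : w φ (a • v) = w φ v := by
  unfold w
  congr 1
  ext i
  simp [ha]

lemma line_sum (φ : ι → V →ₗ[F] F) (c u : V) :
    ∑ a : F, w φ (u + a • c) = (Fintype.card F - 1) * w φ c + Fintype.card F * w0 φ c u := by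
  classical
  have e : ∀ x : ι, ∑ a : F, (if φ x (u + a • c) ≠ 0 then 1 else 0)
      = (Fintype.card F - 1) * (if φ x c ≠ 0 then 1 else 0) +
        Fintype.card F * (if φ x c = 0 ∧ φ x u ≠ 0 then 1 else 0) := by
    intro x
    simp only [map_add, map_smul, smul_eq_mul]
    by_cases hc : φ x c = 0
    · by_cases hu : φ x u = 0 <;> simp [hc, hu]
    · simp only [hc, ne_eq, not_false_eq_true, if_true, false_and, if_false, mul_one, mul_zero, add_zero]
      rw [← card_filter]
      have : (univ.filter fun a : F => ¬ (φ x u + a * φ x c = 0)) = univ.erase (-(φ x u) / φ x c) := by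
        ext a
        simp only [mem_filter, mem_univ, true_and, mem_erase, and_true]
        rw [not_iff_not, eq_div_iff hc, eq_neg_iff_add_eq_zero, add_comm]
      rw [this, card_erase_of_mem (mem_univ _), card_univ]
  simp only [w, w0, card_filter]
  rw [sum_comm]
  simp only [e, sum_add_distrib, mul_sum]

/-- Griesmer codes, abstractly -/
structure Grz (φ : ι → V →ₗ[F] F) (d : ℕ) : Prop where
  pos : 1 ≤ d
  min : ∀ v, v ≠ 0 → d ≤ w φ v
  le : Fintype.card ι ≤ gbound (Fintype.card F) (finrank F V) d

open Classical in
/-- residual code -/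
noncomputable def res (φ : ι → V →ₗ[F] F) (c : V) :
    {i : ι // φ i c = 0} → (V ⧸ Submodule.span F {c}) →ₗ[F] F :=
  fun i => (Submodule.span F {c}).liftQ (φ i.1) (by
    rw [Submodule.span_le]
    intro x hx
    rw [Set.mem_singleton_iff.1 hx]
    exact i.2)

open Classical in
lemma w_res (φ : ι → V →ₗ[F] F) (c u : V) :
    w (res φ c) ((Submodule.span F {c}).mkQ u) = w0 φ c u := by
  simp only [w, w0, res, Submodule.mkQ_apply, Submodule.liftQ_apply]
  rw [← card_map (Function.Embedding.subtype _)]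
  congr 1
  ext i
  simp only [mem_map, Function.Embedding.subtype_apply, Subtype.exists]
  constructor
  · rintro ⟨a, h, h1, rfl⟩
    have h1 := (mem_filter.1 h1).2
    exact mem_filter.2 ⟨mem_univ _, h, h1⟩
  · intro h
    have h1 := (mem_filter.1 h).2
    exact ⟨i, h1.1, mem_filter.2 ⟨mem_univ _, h1.2⟩, rfl⟩

open Classical in
lemma card_res (φ : ι → V →ₗ[F] F) (c : V) :
    Fintype.card {i : ι // φ i c = 0} + w φ c = Fintype.card ι := by
  rw [Fintype.card_subtype, w]
  exact card_filter_add_card_filter_not _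

lemma mk_ne {c u : V} (h : (Submodule.span F {c}).mkQ u ≠ 0) (a : F) : u + a • c ≠ 0 := by
  intro h0
  apply h
  rw [Submodule.mkQ_apply, Submodule.Quotient.mk_eq_zero, Submodule.mem_span_singleton]
  exact ⟨-a, by rw [neg_smul]; exact (eq_neg_of_add_eq_zero_left h0).symm⟩

lemma finrank_res [FiniteDimensional F V] {c : V} (hc : c ≠ 0) :
    finrank F (V ⧸ Submodule.span F {c}) + 1 = finrank F V := by
  have := Submodule.finrank_quotient_add_finrank (Submodule.span F {c})
  rwa [finrank_span_singleton hc] at this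

open Classical in
lemma res_min (φ : ι → V →ₗ[F] F) {c : V} {d : ℕ} (hc : w φ c = d) (hmin : ∀ v, v ≠ 0 → d ≤ w φ v)
    (v : V ⧸ Submodule.span F {c}) (hv : v ≠ 0) :
    (d + Fintype.card F - 1) / Fintype.card F ≤ w (res φ c) v := by
  have h2 := two_le_card (F := F)
  obtain ⟨u, rfl⟩ := Submodule.mkQ_surjective _ v
  rw [w_res]
  have h1 : ∑ a : F, d ≤ ∑ a : F, w φ (u + a • c) := sum_le_sum fun a _ => hmin _ (mk_ne hv a)
  rw [line_sum, hc, sum_const, card_univ, smul_eq_mul] at h1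
  obtain ⟨q, hq⟩ : ∃ q, Fintype.card F = q + 1 := ⟨Fintype.card F - 1, by omega⟩
  rw [hq] at h1 ⊢
  rw [← Nat.lt_succ_iff, Nat.div_lt_iff_lt_mul (by omega)]
  simp only [Nat.add_sub_cancel] at h1
  rw [Nat.succ_eq_add_one]
  have : d + (q + 1) - 1 = d + q := by omega
  rw [this]
  nlinarith

end Codes

lemma cd_pos {q d : ℕ} (hq : 1 ≤ q) (hd : 1 ≤ d) : 1 ≤ (d + q - 1) / q :=
  (Nat.le_div_iff_mul_le hq).2 (by omega)

theorem griesmer_bound {F : Type*} [Field F] [Fintype F] (k : ℕ) :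
    ∀ {V : Type*} [AddCommGroup V] [Module F V] [FiniteDimensional F V] {ι : Type*} [Fintype ι]
      (φ : ι → V →ₗ[F] F) (d : ℕ), finrank F V = k → 1 ≤ d → (∀ v, v ≠ 0 → d ≤ w φ v) →
      gbound (Fintype.card F) k d ≤ Fintype.card ι := by
  classical
  have h2 := two_le_card (F := F)
  induction k with
  | zero => intros; simp [gbound_zero]
  | succ k ih =>
    intro V _ _ _ ι _ φ d hk hd hmin
    have : Nontrivial V := nontrivial_of_finrank_pos (R := F) (by omega)
    have hex : ∃ n, ∃ v : V, v ≠ 0 ∧ w φ v = n := by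
      obtain ⟨v, hv⟩ := exists_ne (0 : V)
      exact ⟨_, v, hv, rfl⟩
    obtain ⟨c, hc0, hc⟩ := Nat.find_spec hex
    have hmin' : ∀ v, v ≠ 0 → w φ c ≤ w φ v := by
      intro v hv
      rw [hc]
      exact Nat.find_min' hex ⟨v, hv, rfl⟩
    have hdc := hmin c hc0
    have := ih (res φ c) ((w φ c + Fintype.card F - 1) / Fintype.card F)
      (by have := finrank_res (F := F) hc0; omega) (cd_pos (by omega) (by omega))
      (res_min φ rfl hmin')
    have hcard := card_res φ c
    calc _ ≤ gbound (Fintype.card F) (k + 1) (w φ c) := gbound_mono hdc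
      _ = w φ c + gbound (Fintype.card F) k ((w φ c + Fintype.card F - 1) / Fintype.card F) :=
        gbound_succ (by omega) _ _
      _ ≤ _ := by omega

section Codes2
variable {F : Type*} [Field F] [Fintype F] {V : Type*} [AddCommGroup V] [Module F V]
  [FiniteDimensional F V]
variable {ι : Type*} [Fintype ι] {φ : ι → V →ₗ[F] F} {d : ℕ}

lemma Grz.exists_min (h : Grz φ d) (hV : 1 ≤ finrank F V) : ∃ c, c ≠ 0 ∧ w φ c = d := by
  have h2 := two_le_card (F := F)
  by_contra hcon
  push Not at hcon
  obtain ⟨k, hk⟩ : ∃ k, finrank F V = k + 1 := ⟨finrank F V - 1, by omega⟩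
  have h1 := griesmer_bound (k + 1) φ (d + 1) hk (by omega) (fun v hv => by
    have := h.min v hv
    have := hcon v hv
    omega)
  have h3 := h.le
  rw [hk] at h3
  have := gbound_lt (q := Fintype.card F) (k := k) (d := d) (by omega)
  omega

lemma Grz.ne_zero (h : Grz φ d) {c : V} (hc : w φ c = d) : c ≠ 0 := by
  rintro rfl
  have := h.pos
  rw [w_zero] at hc; omega

open Classical in
lemma Grz.res (h : Grz φ d) {c : V} (hc : w φ c = d) :
    Grz (res φ c) ((d + Fintype.card F - 1) / Fintype.card F) := by
  have h2 := two_le_card (F := F)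
  refine ⟨cd_pos (by omega) h.pos, res_min φ hc h.min, ?_⟩
  have h1 := finrank_res (F := F) (h.ne_zero hc)
  have h3 := card_res φ c
  have h4 := h.le
  rw [← h1, gbound_succ (by omega)] at h4
  omega

lemma top_of_map {c : V} {W : Submodule F V} (hc : c ∈ W) {B : Set (V ⧸ Submodule.span F {c})}
    (hB : Submodule.span F B = ⊤) (h : ∀ u, (Submodule.span F {c}).mkQ u ∈ B →
      ∃ u' ∈ W, (Submodule.span F {c}).mkQ u' = (Submodule.span F {c}).mkQ u) : W = ⊤ := by
  have h1 : W.map (Submodule.span F {c}).mkQ = ⊤ := by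
    rw [← top_le_iff, ← hB, Submodule.span_le]
    intro v hv
    obtain ⟨u, rfl⟩ := Submodule.mkQ_surjective _ v
    obtain ⟨u', hu', e⟩ := h u hv
    exact ⟨u', hu', e⟩
  have h3 := Submodule.comap_map_mkQ (Submodule.span F {c}) W
  rw [h1, Submodule.comap_top] at h3
  rw [h3]
  symm
  rw [sup_eq_right, Submodule.span_le]
  simpa using hc

end Codes2

theorem span_min {F : Type*} [Field F] [Fintype F] (k : ℕ) :
    ∀ {V : Type*} [AddCommGroup V] [Module F V] [FiniteDimensional F V] {ι : Type*} [Fintype ι]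
      (φ : ι → V →ₗ[F] F) (d : ℕ), finrank F V = k → Grz φ d →
      Submodule.span F {v | w φ v = d} = ⊤ := by
  classical
  have h2 := two_le_card (F := F)
  induction k with
  | zero =>
    intro V _ _ _ ι _ φ d hk _
    have := finrank_zero_iff.1 hk
    exact Subsingleton.elim _ _
  | succ k ih =>
    intro V _ _ _ ι _ φ d hk h
    obtain ⟨c, hc0, hc⟩ := h.exists_min (by omega)
    have h1 := ih (res φ c) _ (by have := finrank_res (F := F) hc0; omega) (h.res hc)
    refine top_of_map (c := c) (Submodule.subset_span hc) h1 ?_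
    intro u hu
    have hu : w (res φ c) ((Submodule.span F {c}).mkQ u) = (d + Fintype.card F - 1) / Fintype.card F := hu
    have hne := (h.res hc).ne_zero hu
    rw [w_res] at hu
    have hs := line_sum φ c u
    rw [hu, hc] at hs
    have hex : ∃ a ∈ (univ : Finset F), w φ (u + a • c) < d + 1 := by
      apply exists_lt_of_sum_lt
      rw [hs, sum_const, card_univ, smul_eq_mul]
      have := Nat.mul_div_le (d + Fintype.card F - 1) (Fintype.card F)
      obtain ⟨q, hq⟩ : ∃ q, Fintype.card F = q + 1 := ⟨Fintype.card F - 1, by omega⟩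
      rw [hq] at this ⊢
      have e : q + 1 - 1 = q := by omega
      have e' : (q + 1) * (d + 1) = q * d + d + q + 1 := by ring
      rw [e, e']
      omega
    obtain ⟨a, _, ha⟩ := hex
    have := h.min _ (mk_ne hne a)
    refine ⟨u + a • c, Submodule.subset_span (by simp only [Set.mem_ofPred_eq]; omega), ?_⟩
    rw [map_add, map_smul]
    have : (Submodule.span F {c}).mkQ c = 0 := by
      rw [Submodule.mkQ_apply, Submodule.Quotient.mk_eq_zero]
      exact Submodule.mem_span_singleton_self c
    rw [this, smul_zero, add_zero]

/-- constant-weight subspaces -/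
def Good {F : Type*} [Field F] [Fintype F] {V : Type*} [AddCommGroup V] [Module F V]
    {ι : Type*} [Fintype ι] (φ : ι → V →ₗ[F] F) (d : ℕ) (E : Submodule F V) : Prop :=
  ∀ x ∈ E, x ≠ 0 → w φ x = d

theorem extension {F : Type*} [Field F] [Fintype F] (r : ℕ) :
    ∀ {V : Type*} [AddCommGroup V] [Module F V] [FiniteDimensional F V] {ι : Type*} [Fintype ι]
      (φ : ι → V →ₗ[F] F) (d : ℕ) (E : Submodule F V), Grz φ d → Fintype.card F ^ r ∣ d →
      Good φ d E → finrank F E ≤ r →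
      Submodule.span F {b | Good φ d (E ⊔ Submodule.span F {b})} = ⊤ := by
  classical
  have h2 := two_le_card (F := F)
  induction r with
  | zero =>
    intro V _ _ _ ι _ φ d E h _ hE hr
    have hE0 : E = ⊥ := Submodule.finrank_eq_zero.1 (by omega)
    rw [← top_le_iff, ← span_min _ φ d rfl h]
    refine Submodule.span_mono ?_
    intro b hb x hx hx0
    rw [hE0, bot_sup_eq, Submodule.mem_span_singleton] at hx
    obtain ⟨a, rfl⟩ := hx
    rw [w_smul _ (by rintro rfl; simp at hx0)]
    exact hb
  | succ r ih =>
    intro V _ _ _ ι _ φ d E h hd hE hr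
    by_cases hE0 : E = ⊥
    · rw [← top_le_iff, ← span_min _ φ d rfl h]
      refine Submodule.span_mono ?_
      intro b hb x hx hx0
      rw [hE0, bot_sup_eq, Submodule.mem_span_singleton] at hx
      obtain ⟨a, rfl⟩ := hx
      rw [w_smul _ (by rintro rfl; simp at hx0)]
      exact hb
    obtain ⟨c, hcE, hc0⟩ := Submodule.exists_mem_ne_zero_of_ne_bot hE0
    have hc := hE c hcE hc0
    obtain ⟨d1, hd1⟩ : Fintype.card F ∣ d := dvd_trans (dvd_pow_self _ (by omega)) hd
    have hdd : Fintype.card F ^ r ∣ d1 := by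
      rw [hd1, pow_succ'] at hd
      exact Nat.dvd_of_mul_dvd_mul_left (by omega) hd
    have hcd : (d + Fintype.card F - 1) / Fintype.card F = d1 := by
      rw [hd1, Nat.add_sub_assoc (by omega), Nat.mul_add_div (by omega), Nat.div_eq_of_lt (by omega), add_zero]
    have hG := h.res hc
    rw [hcd] at hG
    have hlt : finrank F (E.map (Submodule.span F {c}).mkQ) < finrank F E := by
      have h1 := LinearMap.finrank_range_add_finrank_ker ((Submodule.span F {c}).mkQ.domRestrict E)
      rw [LinearMap.range_domRestrict] at h1
      have : 0 < finrank F (LinearMap.ker ((Submodule.span F {c}).mkQ.domRestrict E)) := by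
        rw [Module.finrank_pos_iff]
        refine ⟨⟨⟨⟨c, hcE⟩, ?_⟩, 0, ?_⟩⟩
        · rw [LinearMap.mem_ker, LinearMap.domRestrict_apply, Submodule.mkQ_apply,
            Submodule.Quotient.mk_eq_zero]
          exact Submodule.mem_span_singleton_self c
        · intro e
          apply hc0
          simpa [Subtype.ext_iff] using e
      omega
    have key : ∀ x : V, (Submodule.span F {c}).mkQ x ≠ 0 →
        ((∀ a : F, w φ (x + a • c) = d) ↔ w (res φ c) ((Submodule.span F {c}).mkQ x) = d1) := by
      intro x hx
      have hs := line_sum φ c x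
      rw [w_res]
      rw [hc] at hs
      obtain ⟨q, hq⟩ : ∃ q, Fintype.card F = q + 1 := ⟨Fintype.card F - 1, by omega⟩
      constructor
      · intro hall
        simp only [hall, sum_const, card_univ, smul_eq_mul] at hs
        rw [hq] at hs hd1
        simp only [Nat.add_sub_cancel] at hs
        rw [hd1] at hs
        have : (q + 1) * w0 φ c x = (q + 1) * d1 := by nlinarith
        exact Nat.eq_of_mul_eq_mul_left (by omega) this
      · intro hw a
        rw [hw] at hs
        have h3 : ∑ a : F, d = ∑ a : F, w φ (x + a • c) := by
          rw [hs, sum_const, card_univ, smul_eq_mul]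
          rw [hq] at hd1 ⊢
          simp only [Nat.add_sub_cancel]
          rw [← hd1]; ring
        exact ((sum_eq_sum_iff_of_le fun a _ => h.min _ (mk_ne hx a)).1 h3 a (mem_univ a)).symm
    have hE' : Good (res φ c) d1 (E.map (Submodule.span F {c}).mkQ) := by
      rintro _ ⟨x, hx, rfl⟩ hx0
      rw [← key x hx0]
      intro a
      exact hE _ (E.add_mem hx (E.smul_mem _ hcE)) (mk_ne hx0 a)
    have hB := ih (res φ c) d1 _ hG hdd hE' (by omega)
    refine top_of_map (c := c) (Submodule.subset_span ?_) hB ?_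
    · have : E ⊔ Submodule.span F {c} = E := by
        rw [sup_eq_left, Submodule.span_le]; simpa using hcE
      change Good φ d (E ⊔ Submodule.span F {c})
      rwa [this]
    · intro u hu
      refine ⟨u, Submodule.subset_span ?_, rfl⟩
      have hu : Good (res φ c) d1 (E.map (Submodule.span F {c}).mkQ ⊔
        Submodule.span F {(Submodule.span F {c}).mkQ u}) := hu
      intro x hx hx0
      by_cases hxc : (Submodule.span F {c}).mkQ x = 0
      · apply hE x _ hx0
        rw [Submodule.mkQ_apply, Submodule.Quotient.mk_eq_zero, Submodule.mem_span_singleton] at hxc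
        obtain ⟨a, rfl⟩ := hxc
        exact E.smul_mem _ hcE
      · have hm : (Submodule.span F {c}).mkQ x ∈ E.map (Submodule.span F {c}).mkQ ⊔
            Submodule.span F {(Submodule.span F {c}).mkQ u} := by
          have := Submodule.mem_map_of_mem (f := (Submodule.span F {c}).mkQ) hx
          rwa [Submodule.map_sup, Submodule.map_span, Set.image_singleton] at this
        have := (key x hxc).2 (hu _ hm hxc) 0
        simpa using this

end G18

namespace G18
open Finset Module
set_option linter.unusedSectionVars false
set_option linter.unusedSimpArgs false

lemma arith {p f e : ℕ} (hp : 2 ≤ p) (hf : 1 ≤ f) (he : (f - 1) * (p ^ f - 2) < e)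
    (hne : ¬ (p = 2 ∧ f = 2 ∧ e = 3)) :
    f ≤ e ∧ p ^ (f - 1) - 1 ≤ (e / f - 1) * (p - 1) := by
  obtain ⟨g, rfl⟩ : ∃ g, f = g + 1 := ⟨f - 1, by omega⟩
  simp only [Nat.add_sub_cancel] at he ⊢
  rcases Nat.eq_zero_or_pos g with rfl | hg
  · simp; omega
  have hQ0 : g + 1 ≤ p ^ g := lt_of_lt_of_le (Nat.lt_two_pow_self) (Nat.pow_le_pow_left hp g)
  rw [pow_succ] at he
  by_cases h22 : p = 2 ∧ g = 1
  · obtain ⟨rfl, rfl⟩ := h22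
    simp at he hne ⊢
    omega
  generalize hQ : p ^ g = Q at *
  obtain ⟨P, hP⟩ : ∃ P, Q * p = P + 4 := ⟨Q * p - 4, by nlinarith [Nat.mul_le_mul (show 2 ≤ Q by omega) hp, Nat.sub_add_cancel (show 4 ≤ Q * p by nlinarith)]⟩
  rw [hP] at he
  have e1 : P + 4 - 2 = P + 2 := by omega
  rw [e1] at he
  have hfe : g + 1 ≤ e := by nlinarith
  refine ⟨hfe, ?_⟩
  have hr1 : 1 ≤ e / (g + 1) := (Nat.one_le_div_iff (by omega)).2 hfe
  have hlt := Nat.lt_mul_div_succ e (show 0 < g + 1 by omega)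
  obtain ⟨s, hs⟩ : ∃ s, e / (g + 1) = s + 1 := ⟨e / (g + 1) - 1, by omega⟩
  rw [hs] at hlt ⊢
  simp only [Nat.add_sub_cancel]
  by_contra hcon
  push Not at hcon
  have h3 : g * P ≤ (g + 1) * s := by nlinarith
  obtain ⟨t, rfl⟩ : ∃ t, p = t + 2 := ⟨p - 2, by omega⟩
  obtain ⟨R, rfl⟩ : ∃ R, Q = R + 2 := ⟨Q - 2, by omega⟩
  have e2 : t + 2 - 1 = t + 1 := by omega
  rw [e2] at hcon
  have h4 : s * (t + 1) ≤ R := by omega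
  have hPv : P = R * t + 2 * R + 2 * t := by nlinarith
  have h5 : g * P * (t + 1) ≤ (g + 1) * R := by
    calc _ ≤ (g + 1) * s * (t + 1) := Nat.mul_le_mul_right _ h3
      _ = (g + 1) * (s * (t + 1)) := by ring
      _ ≤ _ := Nat.mul_le_mul_left _ h4
  rcases Nat.eq_zero_or_pos t with rfl | ht
  · simp at hPv h22 h5
    subst hPv
    have hg2 : 2 ≤ g := by omega
    have hR : 1 ≤ R := by omega
    nlinarith [Nat.mul_le_mul hg2 hR]
  · have h6 : g * P * (t + 1) ≥ g * (3 * R + 2) * 2 := by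
      apply Nat.mul_le_mul _ (by omega)
      apply Nat.mul_le_mul_left
      rw [hPv]; nlinarith [Nat.mul_le_mul_left R ht]
    nlinarith [Nat.mul_le_mul_right R hg]

section Spec
variable {F : Type*} [Field F] [Fintype F] {V : Type*} [AddCommGroup V] [Module F V]
  [FiniteDimensional F V]
variable {ι : Type*} [Fintype ι] {φ : ι → V →ₗ[F] F} {d : ℕ}

lemma cube_sum [DecidableEq F] (hq : Fintype.card F = 4) (φ : ι → V →ₗ[F] F) (v : V) :
    ∑ i, (φ i v) ^ 3 = (w φ v : F) := by
  classical
  rw [w, card_filter]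
  push_cast
  refine sum_congr rfl fun i _ => ?_
  by_cases h : φ i v = 0
  · simp [h]
  · have := FiniteField.pow_card_sub_one_eq_one _ h
    rw [hq] at this
    simp [h, this]

lemma spec (hq : Fintype.card F = 4) [CharP F 2] (h : Grz φ d) (hd : 8 ∣ d) (v : V) : 2 ∣ w φ v := by
  classical
  have h4 : ∀ x : F, x ^ 4 = x := fun x => by rw [← hq]; exact FiniteField.pow_card x
  have hadd : ∀ x y : F, (x + y) ^ 2 = x ^ 2 + y ^ 2 := fun x y => add_pow_char x y 2
  have hsumsq : ∀ g : ι → F, (∑ i, g i) ^ 2 = ∑ i, g i ^ 2 := fun g => sum_pow_char 2 _ _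
  have h2 : (2 : F) = 0 := CharP.cast_eq_zero F 2
  have hd0 : (d : F) = 0 := (CharP.cast_eq_zero_iff F 2 d).2 (dvd_trans (by norm_num) hd)
  have key : ∀ c, w φ c = d → ∀ b, ∑ i, (φ i c) ^ 2 * φ i b = 0 := by
    intro c hc
    have hgood : Good φ d (Submodule.span F {c}) := by
      intro x hx hx0
      obtain ⟨a, rfl⟩ := Submodule.mem_span_singleton.1 hx
      rw [w_smul _ (by rintro rfl; simp at hx0), hc]
    have hext := extension 1 φ d _ h (by rw [hq]; exact dvd_trans (by norm_num) hd) hgood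
      (by rw [finrank_span_singleton (h.ne_zero hc)])
    let T : V →ₗ[F] F := ∑ i, (φ i c) ^ 2 • φ i
    have hT : ∀ b, T b = ∑ i, (φ i c) ^ 2 * φ i b := fun b => by simp [T]
    have : T = 0 := by
      refine LinearMap.ext_on hext ?_
      intro b hb
      have hb : Good φ d (Submodule.span F {c} ⊔ Submodule.span F {b}) := hb
      have hw : ∀ x ∈ Submodule.span F {c} ⊔ Submodule.span F {b}, (w φ x : F) = 0 := by
        intro x hx
        by_cases h0 : x = 0
        · rw [h0, w_zero]; simp
        · rw [hb x hx h0, hd0]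
      have hcm : c ∈ Submodule.span F {c} ⊔ Submodule.span F {b} :=
        Submodule.mem_sup_left (Submodule.mem_span_singleton_self c)
      have hbm : b ∈ Submodule.span F {c} ⊔ Submodule.span F {b} :=
        Submodule.mem_sup_right (Submodule.mem_span_singleton_self b)
      have hall : ∀ a : F, a * T b + (a * T b) ^ 2 = 0 := by
        intro a
        have h1 := hw _ (add_mem hcm (Submodule.smul_mem _ a hbm))
        have hc1 := hw _ hcm
        have hb1 := hw _ hbm
        rw [← cube_sum hq] at h1 hc1 hb1
        have e : ∀ i, φ i (c + a • b) ^ 3 = φ i c ^ 3 + a ^ 3 * φ i b ^ 3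
            + a * (φ i c ^ 2 * φ i b) + (a * (φ i c ^ 2 * φ i b)) ^ 2 := by
          intro i
          have hx := h4 (φ i c)
          simp only [map_add, map_smul, smul_eq_mul]
          linear_combination (φ i c ^ 2 * a * φ i b + φ i c * a ^ 2 * φ i b ^ 2) * h2
            - a ^ 2 * φ i b ^ 2 * hx
        simp only [e, sum_add_distrib, ← mul_sum, hc1, hb1, ← hsumsq, ← hT] at h1
        simpa using h1
      by_contra hTb
      have hTb : T b ≠ 0 := hTb
      have : ∀ y : F, y + y ^ 2 = 0 := by
        intro y
        have := hall (y / T b)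
        rwa [div_mul_cancel₀ _ hTb] at this
      have hsub : (univ : Finset F) ⊆ {0, 1} := by
        intro y _
        have := this y
        have h5 : y * (y - 1) = 0 := by linear_combination this - y * h2
        rcases mul_eq_zero.1 h5 with h6 | h6
        · simp [h6]
        · simp [sub_eq_zero.1 h6]
      have h7 := card_le_card hsub
      rw [card_univ, hq] at h7
      have := card_le_two (a := (0 : F)) (b := 1)
      omega
    intro b
    rw [← hT, this, LinearMap.zero_apply]
  let U : V →ₗ[F] F := ∑ i, (φ i v) ^ 2 • φ i
  have hU : ∀ b, U b = ∑ i, (φ i v) ^ 2 * φ i b := fun b => by simp [U]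
  have : U = 0 := by
    refine LinearMap.ext_on (span_min _ φ d rfl h) ?_
    intro c hc
    have h1 := key c hc v
    have h3 : (∑ i, (φ i c) ^ 2 * φ i v) ^ 2 = 0 := by rw [h1]; simp
    rw [hsumsq] at h3
    rw [hU, LinearMap.zero_apply, ← h3]
    refine sum_congr rfl fun i _ => ?_
    linear_combination - φ i v ^ 2 * h4 (φ i c)
  have h9 := hU v
  rw [this, LinearMap.zero_apply] at h9
  rw [← CharP.cast_eq_zero_iff F 2, ← cube_sum hq, h9]
  refine sum_congr rfl fun i _ => ?_
  ring

end Spec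

theorem main {F : Type*} [Field F] [Fintype F] {p f : ℕ} [Fact p.Prime] [CharP F p] (hf : 1 ≤ f)
    (hq : Fintype.card F = p ^ f) (e : ℕ) :
    ∀ {V : Type*} [AddCommGroup V] [Module F V] [FiniteDimensional F V] {ι : Type*} [Fintype ι]
      (φ : ι → V →ₗ[F] F) (d : ℕ), Grz φ d → p ^ e ∣ d →
      ∀ v, p ^ (e - (f - 1) * (p ^ f - 2)) ∣ w φ v := by
  classical
  have hp : p.Prime := Fact.out
  have hp2 := hp.two_le
  have hF2 := two_le_card (F := F)
  induction e using Nat.strong_induction_on with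
  | _ e ih =>
  intro V _ _ _ ι _ φ d h hd
  by_cases hL : e ≤ (f - 1) * (p ^ f - 2)
  · intro v; rw [Nat.sub_eq_zero_of_le hL]; simp
  push Not at hL
  by_cases hsp : p = 2 ∧ f = 2 ∧ e = 3
  · obtain ⟨rfl, rfl, rfl⟩ := hsp
    intro v
    simpa using spec (by simpa using hq) h (by simpa using hd) v
  obtain ⟨hfe, hm⟩ := arith hp2 hf hL hsp
  generalize hLd : (f - 1) * (p ^ f - 2) = L at *
  obtain ⟨s, rfl⟩ : ∃ s, e = L + s + 1 := ⟨e - L - 1, by omega⟩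
  have hEs : L + s + 1 - L = s + 1 := by omega
  rw [hEs]
  have h1 : ∀ v, p ^ s ∣ w φ v := by
    intro v
    have := ih (L + s) (by omega) φ d h (dvd_trans (pow_dvd_pow _ (by omega)) hd) v
    rwa [show L + s - L = s by omega] at this
  have hps : 0 < p ^ s := Nat.pow_pos (by omega)
  choose x hx using h1
  let P : V → F := fun v => (x v : F)
  have hr1 : 1 ≤ (L + s + 1) / f := (Nat.one_le_div_iff (by omega)).2 hfe
  have hqr : Fintype.card F ^ ((L + s + 1) / f) ∣ d := by
    rw [hq, ← pow_mul]
    exact dvd_trans (pow_dvd_pow _ (Nat.mul_div_le _ _)) hd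
  have hsd : p ^ (s + 1) ∣ d := dvd_trans (pow_dvd_pow _ (by omega)) hd
  have hPz : ∀ v, p ^ (s + 1) ∣ w φ v → P v = 0 := by
    intro v hv
    rw [hx v, pow_succ] at hv
    exact (CharP.cast_eq_zero_iff F p _).2 (Nat.dvd_of_mul_dvd_mul_left hps hv)
  have H : CoreHyp p ((L + s + 1) / f) P (Good φ d) := by
    refine ⟨?_, ?_, ?_, ?_, ?_, ?_, ?_⟩
    · intro u
      have := map_natCast (frobenius F p) (x u)
      rw [frobenius_def] at this
      exact this
    · intro a ha u
      have h3 := w_smul φ ha u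
      rw [hx, hx u] at h3
      simp only [P, Nat.eq_of_mul_eq_mul_left hps h3]
    · intro E E' hEE hE y hy hy0
      exact hE y (hEE hy) hy0
    · intro y hy hy0
      exact absurd ((Submodule.mem_bot F).1 hy) hy0
    · intro E hE u hu
      apply hPz
      by_cases hu0 : u = 0
      · rw [hu0, w_zero]; exact dvd_zero _
      · rw [hE u hu hu0]; exact hsd
    · intro E hE c hc u
      by_cases hc0 : c = 0
      · simp [hc0, card_cast]
      have hcd := hE c hc hc0
      have hls := line_sum φ c u
      obtain ⟨d1, hd1⟩ : p ^ f ∣ d := dvd_trans (pow_dvd_pow _ hfe) hd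
      have hdd : p ^ (L + s + 1 - f) ∣ d1 := by
        have hd' := hd
        have hpp : p ^ (L + s + 1) = p ^ f * p ^ (L + s + 1 - f) := by
          rw [← pow_add, Nat.add_sub_cancel' hfe]
        rw [hd1, hpp] at hd'
        exact Nat.dvd_of_mul_dvd_mul_left (Nat.pow_pos (by omega)) hd'
      have hG := h.res hcd
      have hcd1 : (d + Fintype.card F - 1) / Fintype.card F = d1 := by
        rw [hd1, ← hq, Nat.add_sub_assoc (by omega), Nat.mul_add_div (by omega), Nat.div_eq_of_lt (by omega), add_zero]
      rw [hcd1] at hG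
      have h4 := ih (L + s + 1 - f) (by omega) (res φ c) d1 hG hdd ((Submodule.span F {c}).mkQ u)
      rw [w_res] at h4
      have h5 : p ^ (s + 1) ∣ ∑ a : F, w φ (u + a • c) := by
        rw [hls, hcd]
        refine dvd_add (Dvd.dvd.mul_left hsd _) ?_
        rw [hq]
        refine dvd_trans (pow_dvd_pow p (show s + 1 ≤ f + (L + s + 1 - f - L) by omega)) ?_
        rw [pow_add]
        exact mul_dvd_mul_left _ h4
      simp only [hx, ← mul_sum] at h5
      rw [pow_succ] at h5
      have h6 := (CharP.cast_eq_zero_iff F p _).2 (Nat.dvd_of_mul_dvd_mul_left hps h5)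
      simpa [P] using h6
    · intro E hE hEr
      exact extension _ φ d E h hqr hE hEr
  intro v
  have h7 := core hf hq H (m := (L + s + 1) / f - 1) (by omega) hm v
  have h8 := (CharP.cast_eq_zero_iff F p _).1 h7
  rw [hx v, pow_succ]
  exact mul_dvd_mul_left _ h8

end G18

theorem stmt18 {F : Type*} [Field F] [Fintype F] {n k d e p f : ℕ}
    (hp : p.Prime) (hf : 1 ≤ f) (hq : Fintype.card F = p ^ f)
    (C : Submodule F (Fin n → F))
    (hk : Module.finrank F C = k)
    (hn : n = gbound (Fintype.card F) k d)
    (hmin : ∀ c ∈ C, c ≠ 0 → d ≤ wt c)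
    (hex : ∃ c ∈ C, c ≠ 0 ∧ wt c = d)
    (hd : p ^ e ∣ d) :
    ∀ c ∈ C, p ^ (e - (f - 1) * (Fintype.card F - 2)) ∣ wt c := by
  classical
  have : Fact p.Prime := ⟨hp⟩
  have : CharP F p := charP_of_card_eq_prime_pow hq
  let φ : Fin n → C →ₗ[F] F := fun i => (LinearMap.proj i).comp C.subtype
  have hw : ∀ c : C, G18.w φ c = wt (c : Fin n → F) := by
    intro c
    rw [wt, Nat.card_eq_fintype_card, Fintype.card_subtype, G18.w]
    congr 1
  have hG : G18.Grz φ d := by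
    refine ⟨?_, ?_, ?_⟩
    · obtain ⟨c, _, hc0, hc⟩ := hex
      rw [← hc, wt, Nat.card_eq_fintype_card, Nat.one_le_iff_ne_zero, ← Nat.pos_iff_ne_zero,
        Fintype.card_pos_iff]
      obtain ⟨i, hi⟩ := Function.ne_iff.1 hc0
      exact ⟨⟨i, hi⟩⟩
    · intro v hv
      rw [hw]
      exact hmin _ v.2 (fun h0 => hv (Subtype.ext h0))
    · rw [Fintype.card_fin, hk]
      exact hn.le
  intro c hc
  have := G18.main hf hq e φ d hG hd ⟨c, hc⟩
  rw [hw] at this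
  rw [hq]
  exact this
end
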